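/- arXiv:math/0409317 — 3 statements merged into one kernel-verified Lean document; each statement's English description precedes it below -/
import Mathlib

section
/- For each α > 0 there exists p'(α) ∈ (p_c(d),1) such that for every p ∈ (p'(α),1], limsup_{‖x‖₁→∞, x∈ℤ^d} (1/‖x‖₁) · ln ℙ_p( 0↔x and D(0,x) ≥ (1+α)‖x‖₁ ) < 0; i.e. there exist constants A,B > 0 such that ℙ_p( 0↔x and D(0,x) ≥ (1+α)‖x‖₁ ) ≤ A e^{−B‖x‖₁} for all x ∈ ℤ^d. -/
open MeasureTheory Filter
open scoped ENNReal

namespace ChemDist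

/-- Vertices of the lattice `ℤ^d`. -/
abbrev Vert (d : ℕ) := Fin d → ℤ

/-- Nearest-neighbour adjacency on `ℤ^d`: `‖x - y‖₁ = 1`. -/
def adj {d : ℕ} (x y : Vert d) : Prop := (∑ i, |x i - y i|) = 1

/-- The edge set `𝔼^d`, as a predicate on unordered pairs. -/
def IsEdge {d : ℕ} (e : Sym2 (Vert d)) : Prop := ∃ x y : Vert d, adj x y ∧ e = s(x, y)

/-- The type of edges of `ℤ^d`. -/
abbrev EdgeT (d : ℕ) := {e : Sym2 (Vert d) // IsEdge e}

/-- Percolation configurations: `Ω = {0,1}^{𝔼^d}`. -/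
abbrev Config (d : ℕ) := EdgeT d → Bool

/-- `P` is the product Bernoulli measure with parameter `p` over the index `ι`. -/
def IsProductBernoulli {ι : Type*} (p : ℝ) (P : Measure (ι → Bool)) : Prop :=
  IsProbabilityMeasure P ∧
    ∀ (s : Finset ι) (η : ι → Bool),
      P {ω | ∀ e ∈ s, ω e = η e} =
        ∏ e ∈ s, (if η e then ENNReal.ofReal p else ENNReal.ofReal (1 - p))

/-- The edge between adjacent `x` and `y` is open in `ω`. -/
def edgeOpen {d : ℕ} (ω : Config d) (x y : Vert d) : Prop :=
  ∃ h : adj x y, ω ⟨s(x, y), x, y, h, rfl⟩ = true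

/-- The chemical distance `D(x,y)(ω)`: minimal number of edges of an open path from `x`
to `y`, and `+∞` if there is no such path. -/
noncomputable def chemDist {d : ℕ} (ω : Config d) (x y : Vert d) : ℕ∞ :=
  sInf {n : ℕ∞ | ∃ l : List (Vert d),
    List.Chain (edgeOpen ω) x l ∧ (x :: l).getLast (by simp) = y ∧ n = l.length}

/-- Real-valued version of the chemical distance (with value `0` when infinite). -/
noncomputable def chemDistR {d : ℕ} (ω : Config d) (x y : Vert d) : ℝ :=
  ((chemDist ω x y).toNat : ℝ)

/-- `x ↔ y` : `x` and `y` are in the same open cluster. -/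
def Conn {d : ℕ} (ω : Config d) (x y : Vert d) : Prop := chemDist ω x y ≠ ⊤

/-- The open cluster of `x`. -/
def cluster {d : ℕ} (ω : Config d) (x : Vert d) : Set (Vert d) := {y | Conn ω x y}

/-- `x ↔ ∞`. -/
def InfCluster {d : ℕ} (ω : Config d) (x : Vert d) : Prop := (cluster ω x).Infinite

/-- The critical probability `p_c(d)` of Bernoulli bond percolation on `ℤ^d`. -/
noncomputable def pc (d : ℕ) : ℝ :=
  sInf {p : ℝ | p ∈ Set.Icc (0 : ℝ) 1 ∧
    ∀ P : Measure (Config d), IsProductBernoulli p P → 0 < P {ω | InfCluster ω 0}}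

/-- The `ℓ¹` norm on `ℝ^d`. -/
noncomputable def nrm1 {d : ℕ} (x : Fin d → ℝ) : ℝ := ∑ i, |x i|

/-- The Euclidean norm on `ℝ^d`. -/
noncomputable def nrm2 {d : ℕ} (x : Fin d → ℝ) : ℝ := Real.sqrt (∑ i, (x i) ^ 2)

/-- Canonical embedding `ℤ^d → ℝ^d`. -/
def toR {d : ℕ} (x : Vert d) : Fin d → ℝ := fun i => (x i : ℝ)

/-- `μ` is a norm on `ℝ^d`. -/
structure IsNorm {d : ℕ} (μ : (Fin d → ℝ) → ℝ) : Prop where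
  add_le : ∀ x y, μ (x + y) ≤ μ x + μ y
  smul : ∀ (c : ℝ) (x), μ (c • x) = |c| * μ x
  eq_zero_iff : ∀ x, μ x = 0 ↔ x = 0

/-- `μ` is the time constant (Garet–Marchand norm) of the chemical distance at parameter `p`:
it is a norm, and `ℙ_p`-a.s. on `{0 ↔ ∞}`, for every `u ∈ ℤ^d∖{0}` the set
`{k > 0 : ku ↔ ∞}` is infinite and `D(0, T_{n,u} u)/T_{n,u} → μ(u)` where `T_{·,u}` is its
increasing enumeration. -/
def TimeConstant (d : ℕ) (p : ℝ) (μ : (Fin d → ℝ) → ℝ) : Prop :=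
  IsNorm μ ∧
  ∀ P : Measure (Config d), IsProductBernoulli p P →
    ∀ᵐ ω ∂P, InfCluster ω 0 →
      ∀ u : Vert d, u ≠ 0 →
        {k : ℕ | 0 < k ∧ InfCluster ω (k • u)}.Infinite ∧
        Tendsto (fun n : ℕ =>
            chemDistR ω 0 ((Nat.nth (fun k => 0 < k ∧ InfCluster ω (k • u)) n) • u) /
              (Nat.nth (fun k => 0 < k ∧ InfCluster ω (k • u)) n))
          atTop (nhds (μ (toR u)))

variable {d : ℕ}

/-! ### The `*`-lattice -/

/-- `x` and `y` are at sup-distance at most `r`. -/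
def Near (r : ℤ) (x y : Vert d) : Prop := ∀ i, x i ≤ y i + r ∧ y i ≤ x i + r

theorem Near.symm {r : ℤ} {x y : Vert d} (h : Near r x y) : Near r y x := fun i => (h i).symm

theorem Near.refl {r : ℤ} (hr : 0 ≤ r) (x : Vert d) : Near r x x :=
  fun i => by constructor <;> linarith

theorem Near.mono {r s : ℤ} (hrs : r ≤ s) {x y : Vert d} (h : Near r x y) : Near s x y :=
  fun i => by have := h i; omega

theorem Near.trans {r s : ℤ} {x y z : Vert d} (h : Near r x y) (h' : Near s y z) :
    Near (r + s) x z :=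
  fun i => by have := h i; have := h' i; omega

/-- A step of the `*`-lattice that stays in `S`. -/
def StarStep (S : Set (Vert d)) (x y : Vert d) : Prop := x ∈ S ∧ y ∈ S ∧ Near 1 x y

/-- Connection in the `*`-lattice inside `S`. -/
abbrev StarConn (S : Set (Vert d)) : Vert d → Vert d → Prop := Relation.ReflTransGen (StarStep S)

theorem StarConn.symm {S : Set (Vert d)} {x y : Vert d} (h : StarConn S x y) : StarConn S y x := by
  induction h with
  | refl => exact .refl
  | tail _ h ih => exact ih.head ⟨h.2.1, h.1, h.2.2.symm⟩

theorem StarConn.mono {S T : Set (Vert d)} (hST : S ⊆ T) {x y : Vert d} (h : StarConn S x y) :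
    StarConn T x y :=
  Relation.ReflTransGen.mono (fun _ _ h => ⟨hST h.1, hST h.2.1, h.2.2⟩) _ _ h

theorem StarConn.mem {S : Set (Vert d)} {x y : Vert d} (hx : x ∈ S) (h : StarConn S x y) :
    y ∈ S := by
  induction h with
  | refl => exact hx
  | tail _ h _ => exact h.2.1

theorem reflTransGen_of_seq {V : Type*} {r : V → V → Prop} (σ : ℕ → V) {i j : ℕ} (hij : i ≤ j)
    (h : ∀ k, i ≤ k → k < j → r (σ k) (σ (k + 1))) : Relation.ReflTransGen r (σ i) (σ j) := by
  induction j, hij using Nat.le_induction with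
  | base => exact .refl
  | succ j hij ih =>
    exact (ih fun k hk hkj => h k hk (by omega)).tail (h j hij (by omega))

/-! ### Vanishing of the first cohomology of the `*`-lattice, and connectedness of boundaries -/

/-- Move every coordinate one step towards `0`. -/
def shrink (x : Vert d) : Vert d :=
  fun i => if 0 < x i then x i - 1 else if x i < 0 then x i + 1 else 0

theorem near_shrink (x : Vert d) : Near 1 (shrink x) x := fun i => by
  unfold shrink; split_ifs <;> omega

theorem Near.shrink {x y : Vert d} (h : Near 1 x y) : Near 1 (shrink x) (shrink y) := fun i => by
  have := h i
  unfold ChemDist.shrink; split_ifs <;> omega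

/-- The sum of a cochain along the iterates of `shrink`. -/
def potential (f : Vert d → Vert d → ZMod 2) : ℕ → Vert d → ZMod 2
  | 0, _ => 0
  | n + 1, x => f (shrink x) x + potential f n (shrink x)

theorem near_zero_shrink {n : ℕ} {x : Vert d} (h : Near (n + 1 : ℕ) 0 x) :
    Near n 0 (shrink x) := fun i => by
  have := h i
  simp only [Pi.zero_apply] at *
  unfold shrink; push_cast at *; split_ifs <;> omega

theorem shrink_zero : shrink (0 : Vert d) = 0 := by
  funext i; simp [shrink]

theorem eq_zero_of_near {x : Vert d} (h : Near (0 : ℕ) 0 x) : x = 0 := by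
  funext i
  have := h i
  simp only [Pi.zero_apply] at *
  push_cast at *
  omega

theorem exists_near_zero (x : Vert d) : ∃ n : ℕ, Near n 0 x := by
  refine ⟨∑ i, (x i).natAbs, fun i => ?_⟩
  have : (x i).natAbs ≤ ∑ i, (x i).natAbs :=
    Finset.single_le_sum (f := fun i => (x i).natAbs) (fun _ _ => Nat.zero_le _)
      (Finset.mem_univ i)
  simp only [Pi.zero_apply]
  omega

theorem cochain_self {f : Vert d → Vert d → ZMod 2}
    (hf : ∀ x y z, Near 1 x y → Near 1 y z → Near 1 x z → f x z = f x y + f y z)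
    (x : Vert d) : f x x = 0 := by
  have h := Near.refl (r := 1) (by norm_num) x
  simpa using hf x x x h h h

theorem cochain_symm {f : Vert d → Vert d → ZMod 2}
    (hf : ∀ x y z, Near 1 x y → Near 1 y z → Near 1 x z → f x z = f x y + f y z)
    {x y : Vert d} (h : Near 1 x y) : f x y = f y x := by
  have := hf x y x h h.symm (Near.refl (by norm_num) x)
  rw [cochain_self hf] at this
  rw [← CharTwo.add_eq_zero, ← this]

theorem cochain_square {f : Vert d → Vert d → ZMod 2}
    (hf : ∀ x y z, Near 1 x y → Near 1 y z → Near 1 x z → f x z = f x y + f y z)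
    {x y : Vert d} (h : Near 1 x y) :
    f x y = f (shrink x) x + f (shrink x) (shrink y) + f (shrink y) y := by
  obtain ⟨z, hzx, hzy, hzx', hzy'⟩ : ∃ z, Near 1 z x ∧ Near 1 z y ∧ Near 1 z (shrink x) ∧
      Near 1 z (shrink y) := by
    refine ⟨fun i => if (x i).natAbs ≤ (y i).natAbs then x i else y i, ?_, ?_, ?_, ?_⟩ <;>
    · intro i
      have := h i
      try simp only [shrink]
      split_ifs <;> omega
  have h1 := hf x z y hzx.symm hzy h
  have h2 := hf (shrink x) z x hzx'.symm hzx (near_shrink x)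
  have h3 := hf (shrink y) z y hzy'.symm hzy (near_shrink y)
  have h4 := hf (shrink x) z (shrink y) hzx'.symm hzy' h.shrink
  rw [h1, h2, h3, h4, cochain_symm hf hzx, cochain_symm hf hzy']
  have e1 := CharTwo.add_self_eq_zero (f (shrink x) z)
  have e2 := CharTwo.add_self_eq_zero (f (shrink y) z)
  linear_combination -e1 - e2

theorem potential_succ {f : Vert d → Vert d → ZMod 2}
    (hf : ∀ x y z, Near 1 x y → Near 1 y z → Near 1 x z → f x z = f x y + f y z)
    (n : ℕ) (x : Vert d) (hx : Near n 0 x) :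
    potential f (n + 1) x = potential f n x := by
  induction n generalizing x with
  | zero =>
    obtain rfl := eq_zero_of_near hx
    simp [potential, shrink_zero, cochain_self hf]
  | succ n ih =>
    rw [potential, ih _ (near_zero_shrink hx), potential]

theorem potential_eq {f : Vert d → Vert d → ZMod 2}
    (hf : ∀ x y z, Near 1 x y → Near 1 y z → Near 1 x z → f x z = f x y + f y z)
    {m n : ℕ} (hmn : m ≤ n) (x : Vert d) (hx : Near m 0 x) :
    potential f n x = potential f m x := by
  induction n, hmn using Nat.le_induction with
  | base => rfl
  | succ n hmn ih =>
    rw [potential_succ hf n x (hx.mono (by exact_mod_cast hmn)), ih]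

theorem potential_add {f : Vert d → Vert d → ZMod 2}
    (hf : ∀ x y z, Near 1 x y → Near 1 y z → Near 1 x z → f x z = f x y + f y z)
    (n : ℕ) (x y : Vert d) (hx : Near n 0 x) (hy : Near n 0 y)
    (h : Near 1 x y) : f x y = potential f n x + potential f n y := by
  induction n generalizing x y with
  | zero =>
    obtain rfl := eq_zero_of_near hx
    obtain rfl := eq_zero_of_near hy
    simp [potential, cochain_self hf]
  | succ n ih =>
    rw [cochain_square hf h, ih _ _ (near_zero_shrink hx) (near_zero_shrink hy) h.shrink,
      potential, potential]
    ring

/-- Closed `1`-cochains of the `*`-lattice are exact. -/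
theorem exists_potential {f : Vert d → Vert d → ZMod 2}
    (hf : ∀ x y z, Near 1 x y → Near 1 y z → Near 1 x z → f x z = f x y + f y z) :
    ∃ g : Vert d → ZMod 2, ∀ x y, Near 1 x y → f x y = g x + g y := by
  choose N hN using fun x : Vert d => exists_near_zero x
  refine ⟨fun x => potential f (N x) x, fun x y h => ?_⟩
  have hx := le_max_left (N x) (N y)
  have hy := le_max_right (N x) (N y)
  beta_reduce
  rw [← potential_eq hf hx x (hN x), ← potential_eq hf hy y (hN y)]
  exact potential_add hf _ x y ((hN x).mono (by exact_mod_cast hx))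
    ((hN y).mono (by exact_mod_cast hy)) h

theorem crossing_cocycle : ∀ t₁ t₂ t₃ u₁ u₂ u₃ : Bool, (t₁ → ¬u₁) → (t₂ → ¬u₂) → (t₃ → ¬u₃) →
    (t₁ → ¬u₂ → u₃ → t₂) → (t₁ → ¬u₃ → u₂ → t₃) → (t₂ → ¬u₁ → u₃ → t₁) → (t₂ → ¬u₃ → u₁ → t₃) →
    (t₃ → ¬u₁ → u₂ → t₁) → (t₃ → ¬u₂ → u₁ → t₂) →
    (if t₁ ∧ u₃ ∨ u₁ ∧ t₃ then (1 : ZMod 2) else 0) =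
      (if t₁ ∧ u₂ ∨ u₁ ∧ t₂ then 1 else 0) + (if t₂ ∧ u₃ ∨ u₂ ∧ t₃ then 1 else 0) := by
  have two : (0 : ZMod 2) = 1 + 1 := rfl
  rintro (_ | _) (_ | _) (_ | _) (_ | _) (_ | _) (_ | _) <;> simp [← two]

/-- The outer `*`-boundary of `U`. -/
def starBoundary (U : Set (Vert d)) : Set (Vert d) := {y | y ∉ U ∧ ∃ u ∈ U, Near 1 y u}

/-- Boundary points of a `*`-connected set that are `*`-connected in its complement are
`*`-connected in the boundary. -/
theorem starConn_boundary {U : Set (Vert d)} (hU : ∀ u ∈ U, ∀ v ∈ U, StarConn U u v)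
    {a b : Vert d} (ha : a ∈ starBoundary U) (hb : b ∈ starBoundary U)
    (hab : StarConn Uᶜ a b) : StarConn (starBoundary U) a b := by
  classical
  by_contra hcon
  set T : Set (Vert d) := {y | StarConn (starBoundary U) a y} with hT
  have hTU : ∀ y ∈ T, y ∉ U := fun y hy => (StarConn.mem ha hy).1
  have hstep : ∀ x y u, x ∈ T → y ∉ U → u ∈ U → Near 1 x y → Near 1 y u → y ∈ T :=
    fun x y u hx hy hu hxy hyu => Relation.ReflTransGen.tail hx
      ⟨StarConn.mem ha hx, ⟨hy, u, hu, hyu⟩, hxy⟩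
  obtain ⟨g, hg⟩ := exists_potential (d := d)
    (f := fun x y => if (x ∈ T ∧ y ∈ U) ∨ (x ∈ U ∧ y ∈ T) then 1 else 0) (by
      intro x y z hxy hyz hxz
      have h1 := hTU x
      have h2 := hTU y
      have h3 := hTU z
      have a1 := fun h h' h'' => hstep x y z h h' h'' hxy hyz
      have a2 := fun h h' h'' => hstep x z y h h' h'' hxz hyz.symm
      have a3 := fun h h' h'' => hstep y x z h h' h'' hxy.symm hxz
      have a4 := fun h h' h'' => hstep y z x h h' h'' hyz hxz.symm
      have a5 := fun h h' h'' => hstep z x y h h' h'' hxz.symm hxy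
      have a6 := fun h h' h'' => hstep z y x h h' h'' hyz.symm hxy.symm
      have := crossing_cocycle (decide (x ∈ T)) (decide (y ∈ T)) (decide (z ∈ T))
        (decide (x ∈ U)) (decide (y ∈ U)) (decide (z ∈ U))
      simp only [decide_eq_true_eq] at this
      exact this h1 h2 h3 a1 a2 a3 a4 a5 a6)
  have gU : ∀ u ∈ U, ∀ v, StarConn U u v → g u = g v := by
    intro u hu v huv
    induction huv with
    | refl => rfl
    | @tail y z _ h ih =>
      have := hg y z h.2.2
      have h1 : y ∉ T := fun h' => hTU _ h' h.1
      have h2 : z ∉ T := fun h' => hTU _ h' h.2.1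
      simp only [h1, h2, false_and, and_false, or_self, if_false] at this
      rw [ih, ← CharTwo.add_eq_zero, ← this]
  have gab : g a = g b := by
    clear hb hcon
    induction hab with
    | refl => rfl
    | @tail y z _ h ih =>
      have := hg y z h.2.2
      have h1 : y ∉ U := h.1
      have h2 : z ∉ U := h.2.1
      simp only [h1, h2, false_and, and_false, or_self, if_false] at this
      rw [ih, ← CharTwo.add_eq_zero, ← this]
  obtain ⟨haU, u, hu, hau⟩ := ha
  obtain ⟨hbU, v, hv, hbv⟩ := hb
  have e1 := hg a u hau
  have e2 := hg b v hbv
  have haT : a ∈ T := Relation.ReflTransGen.refl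
  have hbT : b ∉ T := hcon
  simp only [haT, hu, hbT, hbU, true_and, false_and, or_self, true_or, if_true, if_false]
    at e1 e2
  rw [gU u hu v (hU u hu v hv), gab, ← e2] at e1
  exact one_ne_zero e1

/-! ### The `ℓ¹` distance and lattice geodesics -/

/-- The `ℓ¹` distance of lattice points. -/
def dist1 (x y : Vert d) : ℤ := ∑ i, |x i - y i|

theorem dist1_self (x : Vert d) : dist1 x x = 0 := by simp [dist1]

theorem dist1_triangle (x y z : Vert d) : dist1 x z ≤ dist1 x y + dist1 y z := by
  rw [dist1, dist1, dist1, ← Finset.sum_add_distrib]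
  exact Finset.sum_le_sum fun i _ => abs_sub_le _ _ _

theorem dist1_comm (x y : Vert d) : dist1 x y = dist1 y x :=
  Finset.sum_congr rfl fun _ _ => abs_sub_comm _ _

theorem near_of_dist1_le {r : ℤ} {x y : Vert d} (h : dist1 x y ≤ r) : Near r x y := fun i => by
  have : |x i - y i| ≤ dist1 x y :=
    Finset.single_le_sum (f := fun i => |x i - y i|) (fun _ _ => abs_nonneg _) (Finset.mem_univ i)
  have := abs_le.1 (this.trans h)
  omega

theorem Near.dist1_le {r : ℤ} {x y : Vert d} (h : Near r x y) : dist1 x y ≤ r * d := by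
  calc dist1 x y ≤ ∑ _i : Fin d, r :=
        Finset.sum_le_sum fun i _ => by have := h i; rw [abs_le]; omega
    _ = r * d := by simp [mul_comm]

theorem adj.near {x y : Vert d} (h : adj x y) : Near 1 x y := near_of_dist1_le (le_of_eq h)

theorem adj.symm {x y : Vert d} (h : adj x y) : adj y x := (dist1_comm y x).trans h

theorem dist1_seq_le {σ : ℕ → Vert d} {n : ℕ} (hσ : ∀ i < n, adj (σ i) (σ (i + 1))) {i j : ℕ}
    (hij : i ≤ j) (hj : j ≤ n) : dist1 (σ i) (σ j) ≤ (j : ℤ) - i := by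
  induction j, hij using Nat.le_induction with
  | base => simp [dist1_self]
  | succ j hij ih =>
    have h1 := ih (by omega)
    have h2 : dist1 (σ j) (σ (j + 1)) = 1 := hσ j (by omega)
    have h3 := dist1_triangle (σ i) (σ j) (σ (j + 1))
    push_cast
    omega

theorem dist1_seq_eq {σ : ℕ → Vert d} {n : ℕ} (hσ : ∀ i < n, adj (σ i) (σ (i + 1)))
    (hn : dist1 (σ 0) (σ n) = n) {i j : ℕ} (hij : i ≤ j) (hj : j ≤ n) :
    dist1 (σ i) (σ j) = (j : ℤ) - i := by
  have h1 := dist1_seq_le hσ (Nat.zero_le i) (hij.trans hj)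
  have h2 := dist1_seq_le hσ hj le_rfl
  have h3 := dist1_seq_le hσ hij hj
  have h4 := dist1_triangle (σ 0) (σ i) (σ n)
  have h5 := dist1_triangle (σ i) (σ j) (σ n)
  push_cast at *
  omega

theorem exists_geodesic (n : ℕ) (x y : Vert d) (h : dist1 x y = n) :
    ∃ σ : ℕ → Vert d, σ 0 = x ∧ σ n = y ∧ ∀ i < n, adj (σ i) (σ (i + 1)) := by
  induction n generalizing x with
  | zero =>
    refine ⟨fun _ => x, rfl, ?_, by simp⟩
    funext i
    have := (Finset.sum_eq_zero_iff_of_nonneg fun i _ => abs_nonneg (x i - y i)).1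
      (h.trans (by simp)) i (Finset.mem_univ i)
    exact sub_eq_zero.1 (abs_eq_zero.1 this)
  | succ n ih =>
    obtain ⟨i, hi⟩ : ∃ i, x i ≠ y i := by
      by_contra! hcon
      obtain rfl : x = y := funext hcon
      rw [dist1_self] at h
      push_cast at h
      omega
    set x' : Vert d := fun j => if j = i then (if x i < y i then x i + 1 else x i - 1) else x j
      with hx'
    have h1 : adj x x' := by
      have : ∀ j, |x j - x' j| = if j = i then 1 else 0 := by
        intro j
        by_cases hj : j = i
        · subst hj
          simp only [hx', if_true]
          split_ifs <;> simp
        · simp [hx', hj]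
      simp [adj, this]
    have h2 : dist1 x' y = n := by
      have : ∀ j, |x' j - y j| = |x j - y j| - if j = i then 1 else 0 := by
        intro j
        by_cases hj : j = i
        · subst hj
          simp only [hx', if_true]
          split_ifs with h
          · rw [abs_of_nonpos (by omega), abs_of_nonpos (by omega)]; ring
          · rw [abs_of_nonneg (by omega), abs_of_nonneg (by omega)]; ring
        · simp [hx', hj]
      simp only [dist1] at h ⊢
      simp only [this, Finset.sum_sub_distrib, h]
      simp
    obtain ⟨σ, h0, hn, hσ⟩ := ih x' h2
    refine ⟨fun k => k.casesOn x σ, rfl, hn, fun k hk => ?_⟩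
    cases k with
    | zero => simpa [h0] using h1
    | succ k => exact hσ k (by omega)

/-! ### Open connections -/

theorem edgeOpen.symm {ω : Config d} {x y : Vert d} (h : edgeOpen ω x y) : edgeOpen ω y x := by
  obtain ⟨h, he⟩ := h
  refine ⟨h.symm, ?_⟩
  rw [← he]
  congr 2
  exact Sym2.eq_swap

/-- A step along an open edge with both ends in `V`. -/
def OpenStep (ω : Config d) (V : Set (Vert d)) (x y : Vert d) : Prop :=
  x ∈ V ∧ y ∈ V ∧ edgeOpen ω x y

/-- Connection by open paths inside `V`. -/
abbrev OpenConn (ω : Config d) (V : Set (Vert d)) : Vert d → Vert d → Prop :=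
  Relation.ReflTransGen (OpenStep ω V)

theorem OpenConn.symm {ω : Config d} {V : Set (Vert d)} {x y : Vert d} (h : OpenConn ω V x y) :
    OpenConn ω V y x := by
  induction h with
  | refl => exact .refl
  | tail _ h ih => exact ih.head ⟨h.2.1, h.1, h.2.2.symm⟩

theorem conn_iff {ω : Config d} {x y : Vert d} :
    Conn ω x y ↔ OpenConn ω Set.univ x y := by
  have : OpenStep ω Set.univ = edgeOpen ω := by
    funext x y; simp [OpenStep]
  rw [OpenConn, this]
  constructor
  · intro h
    have hne : {n : ℕ∞ | ∃ l : List (Vert d), List.IsChain (edgeOpen ω) (x :: l) ∧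
        (x :: l).getLast (by simp) = y ∧ n = l.length}.Nonempty := by
      by_contra hcon
      rw [Set.not_nonempty_iff_eq_empty] at hcon
      exact h ((congrArg sInf hcon).trans sInf_empty)
    obtain ⟨_, l, hl, hy, _⟩ := hne
    exact List.relationReflTransGen_of_exists_isChain_cons l hl hy
  · intro h
    obtain ⟨l, hl, hy⟩ := List.exists_isChain_cons_of_relationReflTransGen h
    have : chemDist ω x y ≤ l.length := sInf_le ⟨l, hl, hy, rfl⟩
    exact ne_top_of_le_ne_top (ENat.natCast_ne_top _) this

/-- The graph of open edges with both ends in `V`. -/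
def openGraph (ω : Config d) (V : Set (Vert d)) : SimpleGraph (Vert d) where
  Adj := OpenStep ω V
  symm := ⟨fun _ _ h => ⟨h.2.1, h.1, h.2.2.symm⟩⟩
  loopless := ⟨fun x h => by
    obtain ⟨_, _, h, _⟩ := h
    simp [adj] at h⟩

theorem chemDistR_lt_card {ω : Config d} {V : Finset (Vert d)} {x y : Vert d} (hx : x ∈ V)
    (h : OpenConn ω V x y) : chemDistR ω x y + 1 ≤ V.card := by
  classical
  obtain ⟨p, hp⟩ := ((SimpleGraph.reachable_iff_reflTransGen (G := openGraph ω V) x y).2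
    h).exists_isPath
  have hsub : ∀ {u v : Vert d} (q : (openGraph ω V).Walk u v), u ∈ V → ∀ z ∈ q.support, z ∈ V := by
    intro u v q
    induction q with
    | nil => simp
    | cons hadj q ih =>
      intro hu z hz
      rw [SimpleGraph.Walk.support_cons, List.mem_cons] at hz
      rcases hz with rfl | hz
      · exact hu
      · exact ih hadj.2.1 z hz
  have hcard : p.length + 1 ≤ V.card := by
    rw [← SimpleGraph.Walk.length_support, ← List.toFinset_card_of_nodup hp.support_nodup]
    exact Finset.card_le_card fun z hz => hsub p hx z (List.mem_toFinset.1 hz)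
  have hle : chemDist ω x y ≤ p.length := by
    refine sInf_le ⟨p.support.tail, ?_, ?_, by simp⟩
    · have := p.isChain_adj_support
      rw [← p.cons_tail_support] at this
      exact this.imp fun _ _ h => h.2.2
    · simp
  have : (chemDist ω x y).toNat ≤ p.length := ENat.toNat_le_of_le_natCast hle
  rw [chemDistR]
  exact_mod_cast (Nat.succ_le_succ this).trans hcard

/-! ### Bad vertices -/

/-- The sup-norm ball of radius `3 * d` around `v`. -/
noncomputable def box (v : Vert d) : Finset (Vert d) :=
  Fintype.piFinset fun i => Finset.Icc (v i - 3 * d) (v i + 3 * d)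

theorem mem_box {v y : Vert d} : y ∈ box v ↔ Near (3 * d) v y := by
  simp only [box, Fintype.mem_piFinset, Finset.mem_Icc, Near]
  refine forall_congr' fun i => ?_
  constructor <;> intro h <;> omega

theorem card_box (v : Vert d) : (box v).card = (6 * d + 1) ^ d := by
  simp only [box, Fintype.card_piFinset, Int.card_Icc]
  rw [Finset.prod_congr rfl fun i _ => show (v i + 3 * d + 1 - (v i - 3 * d)).toNat = 6 * d + 1 by
    omega]
  simp

open scoped Classical in
/-- The edges inside the ball of radius `3 * d` around `v`. -/
noncomputable def boxEdges (v : Vert d) : Finset (EdgeT d) :=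
  (box v ×ˢ box v).biUnion fun q =>
    if h : adj q.1 q.2 then {⟨s(q.1, q.2), q.1, q.2, h, rfl⟩} else ∅

theorem mem_boxEdges {v y z : Vert d} (hy : Near (3 * d) v y) (hz : Near (3 * d) v z)
    (h : adj y z) : (⟨s(y, z), y, z, h, rfl⟩ : EdgeT d) ∈ boxEdges v := by
  classical
  rw [boxEdges, Finset.mem_biUnion]
  exact ⟨(y, z), by simp [mem_box, hy, hz], by simp [h]⟩

theorem near_of_mem_boxEdges {v y : Vert d} {e : EdgeT d} (he : e ∈ boxEdges v) (hy : y ∈ e.1) :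
    Near (3 * d) v y := by
  classical
  rw [boxEdges, Finset.mem_biUnion] at he
  obtain ⟨q, hq, he⟩ := he
  rw [Finset.mem_product, mem_box, mem_box] at hq
  split_ifs at he with h
  · rw [Finset.mem_singleton] at he
    subst he
    rcases Sym2.mem_iff.1 hy with rfl | rfl
    exacts [hq.1, hq.2]
  · simp at he

theorem card_boxEdges_le (v : Vert d) : (boxEdges v).card ≤ ((6 * d + 1) ^ d) ^ 2 := by
  classical
  refine (Finset.card_biUnion_le_card_mul _ _ 1 fun q _ => ?_).trans ?_
  · split_ifs <;> simp
  · simp [card_box, sq]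

/-- A vertex is bad if some edge of the ball of radius `3 * d` around it is closed. -/
def Bad (ω : Config d) : Set (Vert d) := {v | ∃ e ∈ boxEdges v, ω e = false}

theorem edgeOpen_of_not_bad {ω : Config d} {v y z : Vert d} (hv : v ∉ Bad ω)
    (hy : Near (3 * d) v y) (hz : Near (3 * d) v z) (h : adj y z) : edgeOpen ω y z := by
  refine ⟨h, ?_⟩
  by_contra hcon
  exact hv ⟨_, mem_boxEdges hy hz h, by simpa using hcon⟩

/-- A good vertex is connected to the vertices at distance at most `3` by short open paths. -/
theorem openConn_of_not_bad {ω : Config d} {V : Set (Vert d)} {r : ℤ} {a c : Vert d}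
    (ha : a ∉ Bad ω) (hr : r ≤ 3) (hac : Near r a c)
    (hV : ∀ y, Near (r * d) a y → Near (r * d) c y → y ∈ V) : OpenConn ω V a c := by
  obtain ⟨n, hn⟩ : ∃ n : ℕ, dist1 a c = n :=
    Int.eq_ofNat_of_zero_le (Finset.sum_nonneg fun _ _ => abs_nonneg _)
  have hnr : (n : ℤ) ≤ r * d := hn ▸ hac.dist1_le
  have hrd : r * d ≤ 3 * d := mul_le_mul_of_nonneg_right hr (by positivity)
  obtain ⟨σ, rfl, rfl, hσ⟩ := exists_geodesic n a c hn
  have h1 : ∀ k ≤ n, Near (r * d) (σ 0) (σ k) := fun k hk =>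
    near_of_dist1_le (by have := dist1_seq_le hσ (Nat.zero_le k) hk; push_cast at this; omega)
  have h2 : ∀ k ≤ n, Near (r * d) (σ n) (σ k) := fun k hk => Near.symm <|
    near_of_dist1_le (by have := dist1_seq_le hσ hk le_rfl; omega)
  refine reflTransGen_of_seq σ (Nat.zero_le n) fun k _ hk => ⟨?_, ?_, ?_⟩
  · exact hV _ (h1 k (by omega)) (h2 k (by omega))
  · exact hV _ (h1 (k + 1) (by omega)) (h2 (k + 1) (by omega))
  · exact edgeOpen_of_not_bad ha ((h1 k (by omega)).mono hrd) ((h1 (k + 1) (by omega)).mono hrd)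
      (hσ k hk)

/-! ### Detours around bad clusters -/

theorem openConn_seq {ω : Config d} {V : Set (Vert d)} {γ : ℕ → Vert d} {n : ℕ}
    (hγ : ∀ i < n, adj (γ i) (γ (i + 1))) (hn : dist1 (γ 0) (γ n) = n)
    (hV : ∀ i ≤ n, γ i ∈ V) {i j : ℕ} (hi : i ≤ n) (hj : j ≤ n) (hgood : γ i ∉ Bad ω)
    (hij : Near 3 (γ i) (γ j)) : OpenConn ω V (γ i) (γ j) := by
  have key : ∀ {i' j'}, i' ≤ j' → j' ≤ n →
      (∀ k, i' ≤ k → k ≤ j' → Near (3 * d) (γ i) (γ k)) → OpenConn ω V (γ i') (γ j') := by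
    intro i' j' hij' hj' hnear
    refine reflTransGen_of_seq γ hij' fun k hik hkj =>
      ⟨hV _ (by omega), hV _ (by omega), edgeOpen_of_not_bad hgood (hnear _ hik (by omega))
        (hnear _ (by omega) (by omega)) (hγ _ (by omega))⟩
  have h3 := hij.dist1_le
  rcases le_total i j with h | h
  · refine key h hj fun k hik hkj => near_of_dist1_le ?_
    rw [dist1_seq_eq hγ hn h hj] at h3
    rw [dist1_seq_eq hγ hn hik (hkj.trans hj)]
    omega
  · refine (key h hi fun k hik hkj => near_of_dist1_le ?_).symm
    rw [dist1_comm, dist1_seq_eq hγ hn h hi] at h3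
    rw [dist1_comm, dist1_seq_eq hγ hn hkj hi]
    omega

/-- The part of `B` that is `*`-connected to `a` in `Γ ∪ B`. -/
def attached (Γ B : Set (Vert d)) (a : Vert d) : Set (Vert d) := {w ∈ B | StarConn (Γ ∪ B) a w}

/-- Two connected points are connected by an open path that follows a given geodesic and the
neighbourhood of the bad clusters attached to it. -/
theorem openConn_detour {ω : Config d} (hd : 0 < d) {γ : ℕ → Vert d} {n : ℕ}
    (hγ : ∀ i < n, adj (γ i) (γ (i + 1))) (hn : dist1 (γ 0) (γ n) = n)
    (hconn : Conn ω (γ 0) (γ n)) :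
    OpenConn ω (γ '' Set.Iic n ∪
        {v | ∃ w ∈ attached (γ '' Set.Iic n) (Bad ω) (γ 0), Near (3 * d) w v}) (γ 0) (γ n) := by
  set Γ := γ '' Set.Iic n with hΓ
  set W := attached Γ (Bad ω) (γ 0) with hW
  set V := Γ ∪ {v | ∃ w ∈ W, Near (3 * d) w v} with hV
  set U : Set (Vert d) := {u | StarConn (Γ ∪ Bad ω) (γ 0) u} with hU
  have hΓV : ∀ i ≤ n, γ i ∈ V := fun i hi => Or.inl ⟨i, hi, rfl⟩
  have hΓU : ∀ i ≤ n, γ i ∈ U := fun i hi => reflTransGen_of_seq γ (Nat.zero_le i) fun k _ hk =>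
    ⟨Or.inl ⟨k, by simp; omega, rfl⟩, Or.inl ⟨k + 1, by simp; omega, rfl⟩,
      (hγ k (by omega)).near⟩
  have h0 : γ 0 ∈ Γ ∪ Bad ω := Or.inl ⟨0, by simp, rfl⟩
  have hUmem : ∀ u ∈ U, u ∈ Γ ∪ Bad ω := fun u hu => StarConn.mem h0 hu
  have hUconn : ∀ u ∈ U, StarConn U (γ 0) u := by
    intro u hu
    have hu' : StarConn (Γ ∪ Bad ω) (γ 0) u := hu
    induction hu' with
    | refl => exact .refl
    | tail hy h ih => exact (ih hy).tail ⟨hy, hy.tail h, h.2.2⟩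
  have hUU : ∀ u ∈ U, ∀ v ∈ U, StarConn U u v := fun u hu v hv =>
    (hUconn u hu).symm.trans (hUconn v hv)
  have hbU : ∀ y ∈ starBoundary U, y ∉ Bad ω := by
    rintro y ⟨hyU, u, hu, hyu⟩ hbad
    exact hyU (Relation.ReflTransGen.tail hu ⟨hUmem u hu, Or.inr hbad, hyu.symm⟩)
  have hUV : ∀ u ∈ U, u ∈ V := by
    intro u hu
    rcases hUmem u hu with h | h
    · exact Or.inl h
    · exact Or.inr ⟨u, ⟨h, hu⟩, Near.refl (by positivity) u⟩
  have hWV : ∀ w ∈ W, ∀ y, Near (3 * d) w y → y ∈ V := fun w hw y hy => Or.inr ⟨w, hw, hy⟩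
  have hd1 : (1 : ℤ) ≤ d := by exact_mod_cast hd
  -- the points of `V` standing for a boundary point of `U`
  let Rep : Vert d → Vert d → Prop := fun b v =>
    (v = b ∧ ∃ w ∈ W, Near 1 w b) ∨ (v ∈ Γ ∧ v ∉ Bad ω ∧ Near 1 b v)
  have hRep : ∀ b ∈ starBoundary U, ∃ v, Rep b v := by
    rintro b ⟨hbU, u, hu, hbu⟩
    by_cases hbad : u ∈ Bad ω
    · exact ⟨b, Or.inl ⟨rfl, u, ⟨hbad, hu⟩, hbu.symm⟩⟩
    · exact ⟨u, Or.inr ⟨(hUmem u hu).resolve_right hbad, hbad, hbu⟩⟩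
  have hmixed : ∀ b w v, w ∈ W → Near 1 w b → v ∉ Bad ω → Near 2 b v → OpenConn ω V b v := by
    intro b w v hw hwb hv hbv
    refine (openConn_of_not_bad hv (by norm_num) hbv.symm fun y _ hy => ?_).symm
    exact hWV w hw y ((hwb.trans hy).mono (by omega))
  have hstep : ∀ b b' v v', b ∈ starBoundary U → b' ∈ starBoundary U → Near 1 b b' →
      Rep b v → Rep b' v' → OpenConn ω V v v' := by
    rintro b b' v v' hb hb' hbb (⟨rfl, w, hw, hwb⟩ | ⟨hv, hvg, hbv⟩)
      (⟨rfl, w', hw', hwb'⟩ | ⟨hv', hvg', hbv'⟩)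
    · exact hmixed _ w _ hw hwb (hbU _ hb') (hbb.mono (by norm_num))
    · exact hmixed _ w _ hw hwb hvg' (hbb.trans hbv')
    · exact (hmixed _ w' _ hw' hwb' hvg (hbb.symm.trans hbv)).symm
    · obtain ⟨i, hi, rfl⟩ := hv
      obtain ⟨j, hj, rfl⟩ := hv'
      exact openConn_seq hγ hn hΓV hi hj hvg ((hbv.symm.trans hbb).trans hbv')
  have henter : ∀ u a v, u ∈ U → a ∉ U → edgeOpen ω u a → Rep a v → OpenConn ω V u v := by
    rintro u a v hu ha hua (⟨rfl, w, hw, hwb⟩ | ⟨hv, hvg, hbv⟩)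
    · exact .single ⟨hUV u hu, hWV w hw _ (hwb.mono (by omega)), hua⟩
    · have huv : Near 2 u v := hua.1.near.trans hbv
      by_cases hbad : u ∈ Bad ω
      · exact hmixed u u v ⟨hbad, hu⟩ (Near.refl (by norm_num) u) hvg huv
      · obtain ⟨i, hi, rfl⟩ := (hUmem u hu).resolve_right hbad
        obtain ⟨j, hj, rfl⟩ := hv
        exact openConn_seq hγ hn hΓV hi hj hbad (huv.mono (by norm_num))
  have hwalk : ∀ a b v v', a ∈ starBoundary U → StarConn (starBoundary U) a b → Rep a v →
      Rep b v' → OpenConn ω V v v' := by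
    intro a b v v' ha hab hv hv'
    induction hab generalizing v' with
    | refl => exact hstep a a v v' ha ha (Near.refl (by norm_num) a) hv hv'
    | tail _ h ih =>
      obtain ⟨v'', hv''⟩ := hRep _ h.1
      exact (ih v'' hv'').trans (hstep _ _ _ _ h.1 h.2.1 h.2.2 hv'' hv')
  have main : ∀ y, OpenConn ω Set.univ (γ 0) y → (y ∈ U → OpenConn ω V (γ 0) y) ∧
      (y ∉ U → ∃ a v, a ∈ starBoundary U ∧ Rep a v ∧ OpenConn ω V (γ 0) v ∧
        StarConn Uᶜ a y) := by
    intro y hy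
    induction hy with
    | refl => exact ⟨fun _ => .refl, fun h => absurd (hΓU 0 (Nat.zero_le n)) h⟩
    | @tail y z _ hyz ih =>
      obtain ⟨-, -, hyz⟩ := hyz
      have hnear := hyz.1.near
      by_cases hyU : y ∈ U
      · have ih' := ih.1 hyU
        refine ⟨fun hzU => ih'.tail ⟨hUV y hyU, hUV z hzU, hyz⟩, fun hzU => ?_⟩
        have hz : z ∈ starBoundary U := ⟨hzU, y, hyU, hnear.symm⟩
        obtain ⟨v, hv⟩ := hRep z hz
        exact ⟨z, v, hz, hv, ih'.trans (henter y z v hyU hzU hyz hv), .refl⟩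
      · obtain ⟨a, v, ha, hv, h0v, hay⟩ := ih.2 hyU
        refine ⟨fun hzU => ?_, fun hzU => ⟨a, v, ha, hv, h0v, hay.tail ⟨hyU, hzU, hnear⟩⟩⟩
        have hy : y ∈ starBoundary U := ⟨hyU, z, hzU, hnear⟩
        obtain ⟨v', hv'⟩ := hRep y hy
        exact (h0v.trans (hwalk a y v v' ha (starConn_boundary hUU ha hy hay) hv hv')).trans
          (henter z y v' hzU hyU hyz.symm hv').symm
  exact (main _ (conn_iff.1 hconn)).1 (hΓU n le_rfl)

/-- The chemical distance exceeds the `ℓ¹` distance by at most a multiple of the size of the bad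
clusters attached to a geodesic. -/
theorem chemDistR_le {ω : Config d} (hd : 0 < d) {γ : ℕ → Vert d} {n : ℕ}
    (hγ : ∀ i < n, adj (γ i) (γ (i + 1))) (hn : dist1 (γ 0) (γ n) = n)
    (hconn : Conn ω (γ 0) (γ n)) (hfin : (attached (γ '' Set.Iic n) (Bad ω) (γ 0)).Finite) :
    chemDistR ω (γ 0) (γ n) ≤
      n + (attached (γ '' Set.Iic n) (Bad ω) (γ 0)).ncard * ((6 * d + 1) ^ d : ℕ) := by
  classical
  have h := openConn_detour hd hγ hn hconn
  set W := attached (γ '' Set.Iic n) (Bad ω) (γ 0)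
  set F : Finset (Vert d) := (Finset.range (n + 1)).image γ ∪ hfin.toFinset.biUnion box
  have hF : (F : Set (Vert d)) = γ '' Set.Iic n ∪ {v | ∃ w ∈ W, Near (3 * d) w v} := by
    ext v
    simp [F, mem_box]
  rw [← hF] at h
  have h1 := chemDistR_lt_card (Finset.mem_coe.1 (hF ▸ Or.inl ⟨0, by simp, rfl⟩)) h
  have h2 : F.card ≤ (n + 1) + W.ncard * (6 * d + 1) ^ d := by
    refine (Finset.card_union_le _ _).trans (add_le_add ?_ ?_)
    · exact Finset.card_image_le.trans (by simp)
    · rw [Set.ncard_eq_toFinset_card _ hfin]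
      exact Finset.card_biUnion_le_card_mul _ _ _ fun v _ => (card_box v).le
  have h3 : (F.card : ℝ) ≤ (n + 1) + W.ncard * ((6 * d + 1) ^ d : ℕ) := by exact_mod_cast h2
  linarith

/-! ### Covering bad clusters by short walks -/

/-- The steps of the `*`-lattice. -/
abbrev Step (d : ℕ) := {s : Vert d // s ∈ Fintype.piFinset fun _ => Finset.Icc (-1 : ℤ) 1}

theorem card_step (d : ℕ) : Fintype.card (Step d) = 3 ^ d := by
  rw [Fintype.card_coe, Fintype.card_piFinset]
  simp

/-- The vertices visited by the walk with the given steps. -/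
def visited (a : Vert d) : List (Step d) → Finset (Vert d)
  | [] => {a}
  | s :: l => insert a (visited (a + s.1) l)

theorem mem_visited_self (a : Vert d) (l : List (Step d)) : a ∈ visited a l := by
  cases l <;> simp [visited]

theorem card_visited_le (a : Vert d) (l : List (Step d)) :
    (visited a l).card ≤ l.length + 1 := by
  induction l generalizing a with
  | nil => simp [visited]
  | cons s l ih => exact (Finset.card_insert_le _ _).trans (Nat.succ_le_succ (ih _))

theorem sub_mem_step {u v : Vert d} (h : Near 1 u v) :
    v - u ∈ Fintype.piFinset fun _ => Finset.Icc (-1 : ℤ) 1 := by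
  simp only [Fintype.mem_piFinset, Finset.mem_Icc, Pi.sub_apply]
  intro i
  have := h i
  omega

/-- A walk can be made to visit one more vertex at the cost of two more steps. -/
theorem exists_visited_insert (a : Vert d) (l : List (Step d)) {u v : Vert d}
    (hu : u ∈ visited a l) (huv : Near 1 u v) :
    ∃ l' : List (Step d), l'.length = l.length + 2 ∧ insert v (visited a l) ⊆ visited a l' := by
  have detour : ∀ l : List (Step d), ∃ l' : List (Step d), l'.length = l.length + 2 ∧
      insert v (visited u l) ⊆ visited u l' := fun l => by
    refine ⟨⟨v - u, sub_mem_step huv⟩ :: ⟨u - v, sub_mem_step huv.symm⟩ :: l, by simp, ?_⟩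
    simp only [visited, add_sub_cancel]
    intro y
    simp only [Finset.mem_insert]
    tauto
  induction l generalizing a with
  | nil =>
    obtain rfl : u = a := by simpa [visited] using hu
    exact detour []
  | cons s l ih =>
    rw [visited, Finset.mem_insert] at hu
    by_cases hua : u = a
    · subst hua
      exact detour _
    · obtain ⟨l', hl', hsub⟩ := ih _ (hu.resolve_left hua)
      refine ⟨s :: l', by simp [hl'], ?_⟩
      rw [visited, visited, Finset.insert_comm]
      exact Finset.insert_subset_insert _ hsub

theorem exists_walk_seq {γ : ℕ → Vert d} {n : ℕ} (hγ : ∀ i < n, Near 1 (γ i) (γ (i + 1))) :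
    ∃ l : List (Step d), l.length = 2 * n ∧ ∀ i ≤ n, γ i ∈ visited (γ 0) l := by
  induction n with
  | zero => exact ⟨[], rfl, fun i hi => by simp [visited, Nat.le_zero.1 hi]⟩
  | succ n ih =>
    obtain ⟨l, hl, hvis⟩ := ih fun i hi => hγ i (by omega)
    obtain ⟨l', hl', hsub⟩ := exists_visited_insert _ l (hvis n le_rfl) (hγ n (by omega))
    refine ⟨l', by omega, fun i hi => ?_⟩
    rcases Nat.le_succ_iff.1 hi with hi | rfl
    · exact hsub (Finset.mem_insert_of_mem (hvis i hi))
    · exact hsub (Finset.mem_insert_self _ _)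

theorem exists_walk {γ : ℕ → Vert d} {n : ℕ} (hγ : ∀ i < n, Near 1 (γ i) (γ (i + 1)))
    {B : Set (Vert d)} {m : ℕ} (hm : m ≤ (attached (γ '' Set.Iic n) B (γ 0)).encard) :
    ∃ l : List (Step d), l.length = 2 * n + 2 * m ∧ (∀ i ≤ n, γ i ∈ visited (γ 0) l) ∧
      ∃ F ⊆ visited (γ 0) l, (F : Set (Vert d)) ⊆ B ∧ F.card = m := by
  classical
  induction m with
  | zero =>
    obtain ⟨l, hl, hvis⟩ := exists_walk_seq hγ
    exact ⟨l, by simpa using hl, hvis, ∅, by simp, by simp, rfl⟩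
  | succ m ih =>
    obtain ⟨l, hl, hvis, F, hF, hFB, hcard⟩ := ih (le_trans (by norm_cast; omega) hm)
    set W := attached (γ '' Set.Iic n) B (γ 0) with hW
    obtain ⟨y, z, hy, hz, hyz, hzB⟩ : ∃ y z, y ∈ visited (γ 0) l ∧ z ∉ F ∧ Near 1 y z ∧
        z ∈ B := by
      obtain ⟨w, hw, hwF⟩ : ∃ w ∈ W, w ∉ F := by
        by_contra! hcon
        have h1 : W.encard ≤ m := by
          rw [← hcard, ← Set.encard_coe_eq_coe_finsetCard]
          exact Set.encard_le_encard hcon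
        have h2 := hm.trans h1
        norm_cast at h2
        omega
      by_cases hwl : w ∈ visited (γ 0) l
      · exact ⟨w, w, hwl, hwF, Near.refl (by norm_num) w, hw.1⟩
      · have : ∀ u, StarConn (γ '' Set.Iic n ∪ B) (γ 0) u → u ∉ visited (γ 0) l →
            ∃ y z, y ∈ visited (γ 0) l ∧ z ∉ F ∧ Near 1 y z ∧ z ∈ B := by
          intro u hu
          induction hu with
          | refl => exact fun h => absurd (mem_visited_self _ _) h
          | @tail y z _ h ih =>
            intro hz
            by_cases hy : y ∈ visited (γ 0) l
            · refine ⟨y, z, hy, fun h' => hz (hF h'), h.2.2, h.2.1.resolve_left ?_⟩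
              rintro ⟨i, hi, rfl⟩
              exact hz (hvis i hi)
            · exact ih hy
        exact this w hw.2 hwl
    obtain ⟨l', hl', hsub⟩ := exists_visited_insert _ l hy hyz
    refine ⟨l', by omega, fun i hi => hsub (Finset.mem_insert_of_mem (hvis i hi)), insert z F,
      (Finset.insert_subset_insert _ hF).trans hsub, ?_, by simp [hz, hcard]⟩
    rw [Finset.coe_insert]
    exact Set.insert_subset hzB hFB

/-! ### Probability estimates -/

/-- Some walk of length `L` from `a` visits `m` bad vertices. -/
def manyBad (a : Vert d) (L m : ℕ) : Set (Config d) :=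
  {ω | ∃ l : List (Step d), l.length = L ∧
    ∃ F ⊆ visited a l, (F : Set (Vert d)) ⊆ Bad ω ∧ F.card = m}

/-- A set of bad vertices requires proportionally many closed edges. -/
theorem exists_closed_edges {ω : Config d} {V F : Finset (Vert d)} (hFV : F ⊆ V)
    (hF : (F : Set (Vert d)) ⊆ Bad ω) {j : ℕ}
    (hj : (6 * d + 1) ^ d * j < F.card + (6 * d + 1) ^ d) :
    ∃ S : Finset (EdgeT d), (∀ e ∈ S, ∃ v ∈ V, e ∈ boxEdges v) ∧ S.card = j ∧
      ∀ e ∈ S, ω e = false := by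
  classical
  choose φ hφ hφ' using fun v : F => hF v.2
  have hcov : F ⊆ (F.attach.image φ).biUnion fun e : EdgeT d => box e.1.out.1 := fun v hv => by
    rw [Finset.mem_biUnion]
    exact ⟨φ ⟨v, hv⟩, Finset.mem_image_of_mem _ (Finset.mem_attach _ _),
      mem_box.2 (near_of_mem_boxEdges (hφ ⟨v, hv⟩) (Sym2.out_fst_mem _)).symm⟩
  have hcard := (Finset.card_le_card hcov).trans
    (Finset.card_biUnion_le_card_mul _ _ _ fun (e : EdgeT d) _ => (card_box e.1.out.1).le)
  have hj' : j ≤ (F.attach.image φ).card := by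
    by_contra! hcon
    have : ((F.attach.image φ).card + 1) * (6 * d + 1) ^ d ≤ j * (6 * d + 1) ^ d :=
      Nat.mul_le_mul_right _ hcon
    nlinarith
  obtain ⟨S, hS, hSj⟩ := Finset.exists_subset_card_eq hj'
  refine ⟨S, fun e he => ?_, hSj, fun e he => ?_⟩ <;>
    obtain ⟨v, -, rfl⟩ := Finset.mem_image.1 (hS he)
  · exact ⟨v, hFV v.2, hφ v⟩
  · exact hφ' v

theorem measure_closed {ι : Type*} {p : ℝ} {P : Measure (ι → Bool)} (hP : IsProductBernoulli p P)
    (S : Finset ι) : P {ω | ∀ e ∈ S, ω e = false} = ENNReal.ofReal (1 - p) ^ S.card := by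
  have := hP.2 S fun _ => false
  simpa using this

/-- The growth rate in the union bound over walks and sets of edges. -/
def growth (d : ℕ) : ℕ := 3 ^ d * 2 ^ ((6 * d + 1) ^ d) ^ 2

theorem measure_manyBad_le {p : ℝ} (hp : p ≤ 1) {P : Measure (Config d)}
    (hP : IsProductBernoulli p P) (a : Vert d) (L : ℕ) {m j : ℕ}
    (hj : (6 * d + 1) ^ d * j < m + (6 * d + 1) ^ d) :
    P (manyBad a L m) ≤ ENNReal.ofReal ((growth d : ℝ) ^ (L + 1) * (1 - p) ^ j) := by
  classical
  set E : List.Vector (Step d) L → Finset (EdgeT d) := fun l => (visited a l.1).biUnion boxEdges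
  have hE : ∀ l, (E l).card ≤ (L + 1) * ((6 * d + 1) ^ d) ^ 2 := fun l => by
    refine (Finset.card_biUnion_le_card_mul _ _ _ fun v _ => card_boxEdges_le v).trans ?_
    exact Nat.mul_le_mul_right _ ((card_visited_le _ _).trans (by rw [l.2]))
  have hsub : manyBad a L m ⊆ ⋃ l ∈ (Finset.univ : Finset (List.Vector (Step d) L)),
      ⋃ S ∈ (E l).powersetCard j, {ω : Config d | ∀ e ∈ S, ω e = false} := by
    rintro ω ⟨l, hl, F, hFl, hF, rfl⟩
    obtain ⟨S, hS, hSj, hω⟩ := exists_closed_edges hFl hF hj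
    simp only [Set.mem_iUnion]
    refine ⟨⟨l, hl⟩, Finset.mem_univ _, S, Finset.mem_powersetCard.2 ⟨fun e he => ?_, hSj⟩, hω⟩
    exact Finset.mem_biUnion.2 (hS e he)
  have hbound : P (manyBad a L m) ≤
      ((3 ^ d) ^ L * 2 ^ ((L + 1) * ((6 * d + 1) ^ d) ^ 2) : ℕ) * ENNReal.ofReal (1 - p) ^ j := by
    calc P (manyBad a L m)
        ≤ ∑ l : List.Vector (Step d) L, ∑ S ∈ (E l).powersetCard j,
            P {ω : Config d | ∀ e ∈ S, ω e = false} :=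
          (measure_mono hsub).trans <| (measure_biUnion_finset_le _ _).trans <|
            Finset.sum_le_sum fun l _ => measure_biUnion_finset_le _ _
      _ ≤ ∑ l : List.Vector (Step d) L,
            (2 ^ ((L + 1) * ((6 * d + 1) ^ d) ^ 2) : ℕ) * ENNReal.ofReal (1 - p) ^ j := by
          refine Finset.sum_le_sum fun l _ => ?_
          rw [Finset.sum_congr rfl fun S hS => by
            rw [measure_closed hP, (Finset.mem_powersetCard.1 hS).2], Finset.sum_const,
            nsmul_eq_mul, Finset.card_powersetCard]
          gcongr
          exact (Nat.choose_le_two_pow _ _).trans (Nat.pow_le_pow_right (by norm_num) (hE l))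
      _ = _ := by
          rw [Finset.sum_const, Finset.card_univ, card_vector, card_step, nsmul_eq_mul]
          push_cast
          ring
  refine hbound.trans ?_
  rw [ENNReal.ofReal_mul (by positivity), ENNReal.ofReal_pow (by positivity : (0 : ℝ) ≤ growth d),
    ENNReal.ofReal_pow (by linarith : 0 ≤ 1 - p)]
  gcongr
  rw [ENNReal.ofReal_natCast]
  norm_cast
  rw [growth, mul_pow, ← pow_mul 2, mul_comm (L + 1)]
  gcongr
  · exact Nat.one_le_pow _ _ (by norm_num)
  · omega

/-! ### The critical probability is less than one -/

theorem one_le_growth (d : ℕ) : (1 : ℝ) ≤ growth d := by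
  have : 1 ≤ growth d := Nat.one_le_iff_ne_zero.2 (by simp [growth])
  exact_mod_cast this

theorem exists_last {C : Set (Vert d)} (hC : C.Finite) {σ : ℕ → Vert d}
    (hσ : Function.Injective σ) (h0 : σ 0 ∈ C) : ∃ k, σ k ∈ C ∧ ∀ j, k < j → σ j ∉ C := by
  obtain ⟨k, hk, hmax⟩ := Set.exists_max_image (σ ⁻¹' C) id
    (hC.preimage hσ.injOn) ⟨0, h0⟩
  exact ⟨k, hk, fun j hj hjC => absurd (hmax j hjC) (not_le.2 hj)⟩

/-- The boundary of a finite open cluster consists of bad vertices. -/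
theorem starBoundary_cluster_subset (ω : Config d) (x : Vert d) :
    starBoundary (cluster ω x) ⊆ Bad ω := by
  rintro y ⟨hy, u, hu, hyu⟩
  by_contra hbad
  refine hy (conn_iff.2 ((conn_iff.1 hu).trans ?_))
  exact (openConn_of_not_bad hbad (by norm_num) hyu fun _ _ _ => Set.mem_univ _).symm

theorem starConn_cluster (ω : Config d) (x : Vert d) :
    ∀ u ∈ cluster ω x, ∀ v ∈ cluster ω x, StarConn (cluster ω x) u v := by
  have key : ∀ u ∈ cluster ω x, StarConn (cluster ω x) x u := by
    intro u hu
    have h : OpenConn ω Set.univ x u := conn_iff.1 hu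
    clear hu
    induction h with
    | refl => exact .refl
    | tail hy h ih => exact ih.tail ⟨conn_iff.2 hy, conn_iff.2 (hy.tail h), h.2.2.1.near⟩
  exact fun u hu v hv => (key u hu).symm.trans (key v hv)

/-- A `*`-connected set contains points at all intermediate heights. -/
theorem exists_starConn_coord_eq {S : Set (Vert d)} {a b : Vert d} (h : StarConn S a b)
    (i : Fin d) {t : ℤ} (hb : b i ≤ t) (ha : t ≤ a i) : ∃ w, StarConn S a w ∧ w i = t := by
  induction h with
  | refl => exact ⟨a, .refl, le_antisymm hb ha⟩
  | @tail y z hy h ih =>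
    by_cases hyt : y i ≤ t
    · exact ih hyt
    · refine ⟨z, hy.tail h, ?_⟩
      have := h.2.2 i
      omega

/-- The point `(p, q, 0, …, 0)` of the lattice. -/
def planePoint (hd : 2 ≤ d) (p q : ℤ) : Vert d :=
  fun i => if i = ⟨0, by omega⟩ then p else if i = ⟨1, by omega⟩ then q else 0

theorem planePoint_zero (hd : 2 ≤ d) (p q : ℤ) : planePoint hd p q ⟨0, by omega⟩ = p := by
  simp [planePoint]

theorem planePoint_one (hd : 2 ≤ d) (p q : ℤ) : planePoint hd p q ⟨1, by omega⟩ = q := by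
  simp [planePoint]

theorem near_planePoint (hd : 2 ≤ d) {p q p' q' : ℤ} (hp : p ≤ p' + 1 ∧ p' ≤ p + 1)
    (hq : q ≤ q' + 1 ∧ q' ≤ q + 1) : Near 1 (planePoint hd p q) (planePoint hd p' q') :=
  fun i => by
    unfold planePoint
    split_ifs <;> omega

theorem planePoint_zero_zero (hd : 2 ≤ d) : planePoint hd 0 0 = 0 := by
  funext i; simp [planePoint]

theorem exists_near_of_finite {C : Set (Vert d)} (hC : C.Finite) :
    ∃ N : ℕ, ∀ c ∈ C, Near N 0 c := by
  choose N hN using fun x : Vert d => exists_near_zero x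
  obtain ⟨M, hM⟩ := (hC.image N).bddAbove
  exact ⟨M, fun c hc => (hN c).mono (by exact_mod_cast hM ⟨c, hc, rfl⟩)⟩

/-- If the cluster of the origin is finite, there is a large bad cluster near the origin. -/
theorem not_infCluster_subset (hd : 2 ≤ d) :
    {ω : Config d | ¬InfCluster ω 0} ⊆
      ⋃ k : ℕ, manyBad (planePoint hd (k + 1 : ℕ) 0) (2 * (k + 1)) (k + 1) := by
  intro ω hω
  have hC : (cluster ω 0).Finite := Set.not_infinite.1 hω
  set C := cluster ω 0 with hCdef
  have h0 : planePoint hd 0 0 ∈ C := by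
    rw [planePoint_zero_zero]
    exact conn_iff.2 .refl
  obtain ⟨k, hk, hk'⟩ := exists_last hC (σ := fun k => planePoint hd k 0)
    (fun x y h => by simpa [planePoint_zero] using congrFun h ⟨0, by omega⟩) h0
  obtain ⟨l, hl, hl'⟩ := exists_last hC (σ := fun k => planePoint hd 0 k)
    (fun x y h => by simpa [planePoint_one] using congrFun h ⟨1, by omega⟩) h0
  obtain ⟨N, hN⟩ := exists_near_of_finite hC
  set a := planePoint hd (k + 1 : ℕ) 0 with ha
  set b := planePoint hd 0 (l + 1 : ℕ) with hb
  have haC : a ∈ starBoundary C :=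
    ⟨hk' _ (Nat.lt_succ_self k), _, hk, near_planePoint hd (by push_cast; omega) (by omega)⟩
  have hbC : b ∈ starBoundary C :=
    ⟨hl' _ (Nat.lt_succ_self l), _, hl, near_planePoint hd (by omega) (by push_cast; omega)⟩
  obtain ⟨M, hMk, hMl, hMN⟩ : ∃ M : ℕ, k + 1 ≤ M ∧ l + 1 ≤ M ∧ 2 * N < M :=
    ⟨k + l + 2 * N + 1, by omega, by omega, by omega⟩
  have hout : ∀ p q : ℕ, p + q = M → planePoint hd p q ∉ C := by
    intro p q hpq hmem
    have h1 := hN _ hmem ⟨0, by omega⟩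
    have h2 := hN _ hmem ⟨1, by omega⟩
    rw [planePoint_zero, Pi.zero_apply] at h1
    rw [planePoint_one, Pi.zero_apply] at h2
    omega
  have hab : StarConn Cᶜ a b := by
    have h1 : StarConn Cᶜ a (planePoint hd M 0) :=
      reflTransGen_of_seq (fun k : ℕ => planePoint hd k 0) hMk fun j hj _ =>
        ⟨hk' _ (by omega), hk' _ (by omega),
          near_planePoint hd (by push_cast; omega) (by omega)⟩
    have h2 : StarConn Cᶜ b (planePoint hd 0 M) :=
      reflTransGen_of_seq (fun k : ℕ => planePoint hd 0 k) hMl fun j hj _ =>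
        ⟨hl' _ (by omega), hl' _ (by omega),
          near_planePoint hd (by omega) (by push_cast; omega)⟩
    have h3 : StarConn Cᶜ (planePoint hd (M - 0 : ℕ) (0 : ℕ))
        (planePoint hd (M - M : ℕ) (M : ℕ)) :=
      reflTransGen_of_seq (fun k : ℕ => planePoint hd (M - k : ℕ) k) (Nat.zero_le M) fun j _ hj =>
        ⟨hout _ _ (by omega), hout _ _ (by omega),
          near_planePoint hd (by omega) (by push_cast; omega)⟩
    simp only [Nat.sub_zero, Nat.sub_self, Nat.cast_zero] at h3
    exact (h1.trans h3).trans h2.symm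
  have hbad := starBoundary_cluster_subset ω 0
  have hconn : StarConn ({a} ∪ Bad ω) a b :=
    (starConn_boundary (starConn_cluster ω 0) haC hbC hab).mono
      (hbad.trans Set.subset_union_right)
  have haB : {a} ∪ Bad ω = Bad ω := Set.union_eq_self_of_subset_left (by simpa using hbad haC)
  have hcard : ((k + 1 : ℕ) : ℕ∞) ≤ (attached {a} (Bad ω) a).encard := by
    have hsub : Nat.cast '' (Finset.range (k + 1) : Set ℕ) ⊆
        (fun w : Vert d => w ⟨0, by omega⟩) '' attached {a} (Bad ω) a := by
      rintro _ ⟨t, ht, rfl⟩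
      have ht' : t < k + 1 := by simpa using ht
      obtain ⟨w, hw, hwt⟩ := exists_starConn_coord_eq hconn ⟨0, by omega⟩ (t := t)
        (by rw [hb, planePoint_zero]; omega) (by rw [ha, planePoint_zero]; omega)
      exact ⟨w, ⟨StarConn.mem (hbad haC) (haB ▸ hw), hw⟩, hwt⟩
    refine le_trans ?_ ((Set.encard_le_encard hsub).trans (Set.encard_image_le _ _))
    rw [Nat.cast_injective.encard_image, Set.encard_coe_eq_coe_finsetCard, Finset.card_range]
  have himg : (fun _ : ℕ => a) '' Set.Iic 0 = {a} :=
    Set.Nonempty.image_const ⟨0, by simp⟩ a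
  obtain ⟨w, hw, -, F, hF⟩ := exists_walk (γ := fun _ => a) (n := 0) (by simp) (B := Bad ω)
    (m := k + 1) (himg.symm ▸ hcard)
  exact Set.mem_iUnion.2 ⟨k, w, by simpa using hw, F, hF⟩

theorem pc_lt_one (hd : 2 ≤ d) : pc d < 1 := by
  set M : ℝ := (growth d : ℝ) with hM
  set K : ℕ := (6 * d + 1) ^ d with hK
  have hM1 : 1 ≤ M := one_le_growth d
  have hK0 : 0 < K := by positivity
  set η : ℝ := 1 / (4 * M ^ 3) with hη
  have hη0 : 0 < η := by positivity
  have hη1 : η ≤ 1 := by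
    rw [hη, div_le_one (by positivity)]
    nlinarith [one_le_pow₀ hM1 (n := 3)]
  have hηK : η ^ K ≤ 1 := pow_le_one₀ hη0.le hη1
  have hlt : 1 - η ^ K < 1 := by linarith [pow_pos hη0 K]
  refine lt_of_le_of_lt (csInf_le ⟨0, fun p hp => hp.1.1⟩ ⟨⟨by linarith, hlt.le⟩, ?_⟩) hlt
  intro P hP
  have hterm : ∀ k : ℕ, P (manyBad (planePoint hd (k + 1 : ℕ) 0) (2 * (k + 1)) (k + 1)) ≤
      ENNReal.ofReal ((1 / 4) * (1 / 4) ^ k) := by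
    intro k
    have hdiv := Nat.div_add_mod (k + K) K
    have hmod := Nat.mod_lt (k + K) hK0
    refine (measure_manyBad_le hlt.le hP _ _ (j := (k + K) / K) (by rw [← hK]; omega)).trans
      (ENNReal.ofReal_le_ofReal ?_)
    calc M ^ (2 * (k + 1) + 1) * (1 - (1 - η ^ K)) ^ ((k + K) / K)
        = M ^ (2 * (k + 1) + 1) * η ^ (K * ((k + K) / K)) := by rw [sub_sub_cancel, pow_mul]
      _ ≤ M ^ (3 * (k + 1)) * η ^ (k + 1) :=
          mul_le_mul (pow_le_pow_right₀ hM1 (by omega))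
            (pow_le_pow_of_le_one hη0.le hη1 (by omega)) (by positivity) (by positivity)
      _ = (1 / 4) * (1 / 4) ^ k := by
          rw [pow_mul, ← mul_pow, ← pow_succ', hη]
          congr 1
          field_simp
  have hsum : HasSum (fun k : ℕ => (1 / 4 : ℝ) * (1 / 4) ^ k) (1 / 4 * (1 - 1 / 4)⁻¹) :=
    (hasSum_geometric_of_lt_one (by norm_num) (by norm_num)).mul_left _
  have hfin : P {ω | ¬InfCluster ω 0} < 1 := by
    calc P {ω | ¬InfCluster ω 0}
        ≤ ∑' k : ℕ, ENNReal.ofReal ((1 / 4) * (1 / 4) ^ k) :=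
          (measure_mono (not_infCluster_subset hd)).trans <|
            (measure_iUnion_le _).trans (ENNReal.tsum_le_tsum hterm)
      _ = ENNReal.ofReal (1 / 4 * (1 - 1 / 4)⁻¹) := by
          rw [← ENNReal.ofReal_tsum_of_nonneg (fun k => by positivity) hsum.summable,
            hsum.tsum_eq]
      _ < 1 := by
          rw [ENNReal.ofReal_lt_one]
          norm_num
  have := hP.1
  by_contra hcon
  have h0 : P {ω | InfCluster ω 0} = 0 := by simpa using hcon
  have huniv : P Set.univ ≤ P {ω | InfCluster ω 0} + P {ω | ¬InfCluster ω 0} :=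
    (measure_mono fun ω _ => em (InfCluster ω 0)).trans (measure_union_le _ _)
  rw [measure_univ, h0, zero_add] at huniv
  exact absurd hfin (not_lt.2 huniv)

/-! ### Large deviations of the chemical distance -/

theorem nrm1_toR {x : Vert d} {n : ℕ} (h : dist1 0 x = n) : nrm1 (toR x) = n := by
  have : nrm1 (toR x) = ((dist1 0 x : ℤ) : ℝ) := by simp [nrm1, toR, dist1]
  rw [this, h, Int.cast_natCast]

/-- A large chemical distance forces a large number of bad vertices on a short walk. -/
theorem chemDist_large_subset (hd : 0 < d) {α : ℝ} {q : ℕ}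
    (hq : (((6 * d + 1) ^ d : ℕ) : ℝ) ^ 2 ≤ α * q) (hα : 0 < α) {x : Vert d} {n : ℕ}
    (hn : dist1 0 x = n) :
    {ω : Config d | Conn ω 0 x ∧ (1 + α) * n ≤ chemDistR ω 0 x} ⊆
      manyBad 0 (2 * n + 2 * ((6 * d + 1) ^ d * (n / q))) ((6 * d + 1) ^ d * (n / q)) := by
  rintro ω ⟨hconn, hω⟩
  obtain ⟨γ, h0, rfl, hγ⟩ := exists_geodesic n 0 x hn
  rw [← h0] at hn hconn hω ⊢
  set K : ℕ := (6 * d + 1) ^ d with hK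
  have hK0 : (0 : ℝ) < K := by positivity
  have hm : ((K * (n / q) : ℕ) : ℕ∞) ≤ (attached (γ '' Set.Iic n) (Bad ω) (γ 0)).encard := by
    by_contra! hcon
    have hfin := Set.finite_of_encard_le_coe hcon.le
    have h1 := chemDistR_le hd hγ hn hconn hfin
    rw [← hfin.cast_ncard_eq, Nat.cast_lt] at hcon
    set w := (attached (γ '' Set.Iic n) (Bad ω) (γ 0)).ncard
    have h2 : (w : ℝ) + 1 ≤ K * (n / q : ℕ) := by exact_mod_cast hcon
    have h3 : ((n / q : ℕ) : ℝ) * q ≤ n := by exact_mod_cast Nat.div_mul_le_self n q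
    have h4 : (w : ℝ) * K + K ≤ α * n := by
      calc (w : ℝ) * K + K = (w + 1) * K := by ring
        _ ≤ K * (n / q : ℕ) * K := by gcongr
        _ = (K : ℝ) ^ 2 * (n / q : ℕ) := by ring
        _ ≤ α * q * (n / q : ℕ) := by gcongr
        _ = α * ((n / q : ℕ) * q) := by ring
        _ ≤ α * n := by gcongr
    linarith
  obtain ⟨l, hl, -, F, hF⟩ := exists_walk (fun i hi => (hγ i hi).near) hm
  exact ⟨l, hl, F, hF⟩

/-- **Chemical distance for `p` close to `1`.**  For each `α > 0` there exists
`p'(α) ∈ (p_c(d), 1)` such that for every `p ∈ (p'(α), 1]` there are `A, B > 0` with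
`ℙ_p(0 ↔ x, D(0,x) ≥ (1+α)‖x‖₁) ≤ A e^{-B‖x‖₁}` for all `x ∈ ℤ^d`. -/
theorem chemDist_close_to_one (d : ℕ) (hd : 2 ≤ d) (α : ℝ) (hα : 0 < α) :
    ∃ p' : ℝ, pc d < p' ∧ p' < 1 ∧
      ∀ p : ℝ, p' < p → p ≤ 1 →
        ∀ P : Measure (Config d), IsProductBernoulli p P →
          ∃ A B : ℝ, 0 < A ∧ 0 < B ∧ ∀ x : Vert d,
            P {ω | Conn ω 0 x ∧ (1 + α) * nrm1 (toR x) ≤ chemDistR ω 0 x} ≤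
              ENNReal.ofReal (A * Real.exp (-B * nrm1 (toR x))) := by
  set M : ℝ := (growth d : ℝ) with hM
  set K : ℕ := (6 * d + 1) ^ d with hK
  have hM1 : 1 ≤ M := one_le_growth d
  obtain ⟨q, hq⟩ : ∃ q : ℕ, (K : ℝ) ^ 2 / α < q := exists_nat_gt _
  have hq0 : (0 : ℝ) < q := lt_of_le_of_lt (by positivity) hq
  have hq' : (K : ℝ) ^ 2 ≤ α * q := ((div_lt_iff₀' hα).1 hq).le
  set δ : ℝ := Real.exp (-1) / M ^ (2 * q + 2 * K) with hδ
  have hδ0 : 0 < δ := by positivity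
  have hpc := pc_lt_one hd
  refine ⟨max (1 - δ) ((pc d + 1) / 2), lt_max_of_lt_right (by linarith),
    max_lt (by linarith) (by linarith), ?_⟩
  intro p hp hp1 P hP
  have hpδ : 1 - p ≤ δ := by linarith [(le_max_left _ _).trans_lt hp]
  refine ⟨M ^ (2 * q + 1) * Real.exp 1, 1 / q, by positivity, by positivity, fun x => ?_⟩
  obtain ⟨n, hn⟩ : ∃ n : ℕ, dist1 0 x = n :=
    Int.eq_ofNat_of_zero_le (Finset.sum_nonneg fun _ _ => abs_nonneg _)
  rw [nrm1_toR hn]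
  refine (measure_mono (chemDist_large_subset (by omega) hq' hα hn)).trans <|
    (measure_manyBad_le hp1 hP 0 _ (j := n / q)
      (Nat.lt_add_of_pos_right (by positivity))).trans (ENNReal.ofReal_le_ofReal ?_)
  rw [← hM, ← hK]
  set k := n / q with hk
  have hnk : n ≤ q * (k + 1) := (Nat.lt_mul_div_succ n (by exact_mod_cast hq0)).le
  calc M ^ (2 * n + 2 * (K * k) + 1) * (1 - p) ^ k
      ≤ M ^ ((2 * q + 1) + (2 * q + 2 * K) * k) * δ ^ k := by
        refine mul_le_mul (pow_le_pow_right₀ hM1 ?_)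
          (pow_le_pow_left₀ (by linarith) hpδ k) (pow_nonneg (by linarith) k) (by positivity)
        nlinarith
    _ = M ^ (2 * q + 1) * (M ^ (2 * q + 2 * K) * δ) ^ k := by
        rw [pow_add, pow_mul, mul_pow, mul_assoc]
    _ = M ^ (2 * q + 1) * Real.exp (-k) := by
        rw [hδ, mul_div_cancel₀ _ (by positivity), ← Real.exp_nat_mul]
        ring_nf
    _ ≤ M ^ (2 * q + 1) * Real.exp (1 + -(1 / q) * n) := by
        gcongr
        have : (n : ℝ) ≤ q * (k + 1) := by exact_mod_cast hnk
        have : (n : ℝ) / q ≤ k + 1 := (div_le_iff₀' hq0).2 this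
        have h2 : -(1 / (q : ℝ)) * n = -(n / q) := by ring
        linarith
    _ = M ^ (2 * q + 1) * Real.exp 1 * Real.exp (-(1 / q) * n) := by
        rw [Real.exp_add, mul_assoc]

end ChemDist
end

section
/- The map p ↦ μ_p is continuous at p = 1 in the uniform sense: lim_{p→1} sup_{x∈ℝ^d, ‖x‖₁≤1} | μ_p(x) − ‖x‖₁ | = 0. In particular, for every α > 0 there exists p' ∈ (p_c(d),1) such that for all p ∈ (p',1] and all x ∈ ℝ^d, ‖x‖₁ ≤ μ_p(x) ≤ (1+α)‖x‖₁. -/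
open MeasureTheory Filter
open scoped ENNReal

namespace ChemDist

section ChemicalDistance

variable {d : ℕ} {ω : Config d} {x y z : Vert d}

lemma adj_symm (h : adj x y) : adj y x := by
  unfold adj at *
  simpa only [abs_sub_comm] using h

lemma edgeOpen_symm (h : edgeOpen ω x y) : edgeOpen ω y x := by
  obtain ⟨hxy, ho⟩ := h
  refine ⟨adj_symm hxy, ?_⟩
  rw [← ho]
  congr 1
  exact Subtype.ext Sym2.eq_swap

lemma chemDist_le {l : List (Vert d)} (hl : List.IsChain (edgeOpen ω) (x :: l))
    (hy : (x :: l).getLast (by simp) = y) : chemDist ω x y ≤ l.length :=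
  sInf_le ⟨l, hl, hy, rfl⟩

lemma conn_iff_exists_chain : Conn ω x y ↔
    ∃ l : List (Vert d), List.IsChain (edgeOpen ω) (x :: l) ∧
      (x :: l).getLast (by simp) = y := by
  constructor
  · intro h
    by_contra! hne
    apply h
    refine sInf_eq_top.2 ?_
    rintro n ⟨l, hl, hy, -⟩
    exact absurd hy (hne l hl)
  · rintro ⟨l, hl, hy⟩
    exact ne_top_of_le_ne_top (ENat.natCast_ne_top _) (chemDist_le hl hy)

lemma conn_iff_reflTransGen : Conn ω x y ↔ Relation.ReflTransGen (edgeOpen ω) x y := by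
  rw [conn_iff_exists_chain]
  constructor
  · rintro ⟨l, hl, hy⟩
    exact List.relationReflTransGen_of_exists_isChain_cons l hl hy
  · intro h
    obtain ⟨l, hl, hy⟩ := List.exists_isChain_cons_of_relationReflTransGen h
    exact ⟨l, hl, hy⟩

lemma Conn.symm (h : Conn ω x y) : Conn ω y x := by
  rw [conn_iff_reflTransGen] at *
  have : Std.Symm (edgeOpen ω) := ⟨fun _ _ => edgeOpen_symm⟩
  exact Relation.ReflTransGen.stdSymm.symm _ _ h

lemma Conn.trans (h : Conn ω x y) (h' : Conn ω y z) : Conn ω x z := by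
  rw [conn_iff_reflTransGen] at *
  exact Relation.ReflTransGen.trans h h'

lemma InfCluster.of_conn (h : InfCluster ω x) (hxy : Conn ω x y) : InfCluster ω y :=
  Set.Infinite.mono (fun _ hz => hxy.symm.trans hz) h

lemma sum_abs_sub_le_length (l : List (Vert d)) :
    ∀ x : Vert d, List.IsChain (edgeOpen ω) (x :: l) →
      ∑ i, |x i - (x :: l).getLast (by simp) i| ≤ l.length := by
  induction l with
  | nil => intro x _; simp
  | cons y l ih =>
    intro x hx
    rw [List.isChain_cons_cons] at hx
    obtain ⟨⟨hxy, -⟩, hl⟩ := hx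
    have h1 := ih y hl
    rw [List.getLast_cons_cons]
    calc _ ≤ ∑ i, (|x i - y i| + |y i - (y :: l).getLast (by simp) i|) :=
          Finset.sum_le_sum fun i _ => abs_sub_le _ _ _
      _ = 1 + ∑ i, |y i - (y :: l).getLast (by simp) i| := by
          rw [Finset.sum_add_distrib, show ∑ i, |x i - y i| = 1 from hxy]
      _ ≤ _ := by push_cast [List.length_cons]; linarith

/-- A finite chemical distance is at least the `ℓ¹` distance. -/
lemma nrm1_le_chemDistR (h : Conn ω 0 y) : nrm1 (toR y) ≤ chemDistR ω 0 y := by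
  have hne : {n : ℕ∞ | ∃ l : List (Vert d), List.Chain (edgeOpen ω) 0 l ∧
      ((0 : Vert d) :: l).getLast (by simp) = y ∧ n = l.length}.Nonempty := by
    obtain ⟨l, hl, hy⟩ := conn_iff_exists_chain.1 h
    exact ⟨_, l, hl, hy, rfl⟩
  obtain ⟨l, hl, hy, hn⟩ := csInf_mem hne
  have hlen : chemDistR ω 0 y = l.length := by
    unfold chemDistR chemDist
    rw [hn]; simp
  have h1 := sum_abs_sub_le_length l 0 hl
  rw [hy] at h1
  rw [hlen]
  have h2 : ((∑ i, |(0 : Vert d) i - y i| : ℤ) : ℝ) ≤ ((l.length : ℤ) : ℝ) := by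
    exact_mod_cast h1
  simpa [nrm1, toR] using h2

lemma chemDist_le_of_walk {V : Type*} {G : SimpleGraph V} (f : V → Vert d)
    (hf : ∀ a b, G.Adj a b → edgeOpen ω (f a) (f b)) {u v : V} (w : G.Walk u v) :
    chemDist ω (f u) (f v) ≤ w.length := by
  suffices ∃ l : List (Vert d), List.IsChain (edgeOpen ω) (f u :: l) ∧
      (f u :: l).getLast (by simp) = f v ∧ l.length = w.length by
    obtain ⟨l, hl, hv, hlen⟩ := this
    rw [← hlen]
    exact chemDist_le hl hv
  induction w with
  | nil => exact ⟨[], by simp, by simp, by simp⟩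
  | @cons a b c h w ih =>
    obtain ⟨l, hl, hv, hlen⟩ := ih
    exact ⟨f b :: l, by rw [List.isChain_cons_cons]; exact ⟨hf _ _ h, hl⟩,
      by rwa [List.getLast_cons_cons], by simp [hlen]⟩

end ChemicalDistance

section Quadrant

/-- Edges of the quadrant `ℕ²`: `(true, a, b)` joins `(a, b)` to `(a + 1, b)` and
`(false, a, b)` joins `(a, b)` to `(a, b + 1)`. -/
abbrev QEdge := Bool × ℕ × ℕ

/-- The upper right endpoint of an edge of the quadrant. -/
def qTarget (e : QEdge) : ℕ × ℕ := bif e.1 then (e.2.1 + 1, e.2.2) else (e.2.1, e.2.2 + 1)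

/-- The unordered pair of endpoints of an edge of the quadrant. -/
def qEnds (e : QEdge) : Sym2 (ℕ × ℕ) := s(e.2, qTarget e)

/-- The four edges of the unit square with lower left corner `c`. -/
def plaquette (c : ℕ × ℕ) : Finset QEdge :=
  {(true, c.1, c.2), (true, c.1, c.2 + 1), (false, c.1, c.2), (false, c.1 + 1, c.2)}

/-- The unit squares in `[0, k]²`. -/
def squares (k : ℕ) : Finset (ℕ × ℕ) := Finset.range k ×ˢ Finset.range k

lemma ne_qTarget (e : QEdge) : e.2 ≠ qTarget e := by
  obtain ⟨_ | _, a, b⟩ := e <;> simp [qTarget]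

lemma mem_plaquette_true {a b : ℕ} {c : ℕ × ℕ} :
    (true, a, b) ∈ plaquette c ↔ (a, b) = c ∨ (0 < b ∧ (a, b - 1) = c) := by
  obtain ⟨x, y⟩ := c
  simp only [plaquette, Finset.mem_insert, Finset.mem_singleton, Prod.mk.injEq, true_and,
    Bool.true_eq_false, false_and, or_false]
  omega

lemma mem_plaquette_false {a b : ℕ} {c : ℕ × ℕ} :
    (false, a, b) ∈ plaquette c ↔ (a, b) = c ∨ (0 < a ∧ (a - 1, b) = c) := by
  obtain ⟨x, y⟩ := c
  simp only [plaquette, Finset.mem_insert, Finset.mem_singleton, Prod.mk.injEq, true_and,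
    Bool.false_eq_true, false_and, false_or]
  omega

lemma card_plaquette_le (c : ℕ × ℕ) : (plaquette c).card ≤ 4 := Finset.card_le_four

/-- The `ℤ/2`-chain given by the bottom side of `[0, k]²` plus the boundaries of the unit squares
in `S`. -/
noncomputable def detourChain (k : ℕ) (S : Finset (ℕ × ℕ)) : QEdge →₀ ZMod 2 :=
  ∑ a ∈ Finset.range k, Finsupp.single (true, a, 0) 1 +
    ∑ c ∈ S, ∑ e ∈ plaquette c, Finsupp.single e 1

lemma detourChain_apply (k : ℕ) (S : Finset (ℕ × ℕ)) (e : QEdge) :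
    detourChain k S e = (∑ a ∈ Finset.range k, if (true, a, 0) = e then 1 else 0) +
      ∑ c ∈ S, if e ∈ plaquette c then 1 else 0 := by
  simp only [detourChain, Finsupp.add_apply, Finsupp.finsetSum_apply, Finsupp.single_apply,
    Finset.sum_ite_eq']

lemma card_support_detourChain_le (k : ℕ) (S : Finset (ℕ × ℕ)) :
    (detourChain k S).support.card ≤ k + 4 * S.card := by
  have hsub : (detourChain k S).support ⊆
      (Finset.range k).image (fun a => ((true, a, 0) : QEdge)) ∪ S.biUnion plaquette := by
    intro e he
    by_contra hne
    simp only [Finset.mem_union, Finset.mem_image, Finset.mem_biUnion, not_or, not_exists,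
      not_and] at hne
    rw [Finsupp.mem_support_iff, detourChain_apply] at he
    apply he
    rw [Finset.sum_eq_zero fun a ha => if_neg (hne.1 a ha),
      Finset.sum_eq_zero fun c hc => if_neg (hne.2 c hc), add_zero]
  refine (Finset.card_le_card hsub).trans ((Finset.card_union_le _ _).trans ?_)
  refine add_le_add (Finset.card_image_le.trans (by simp)) ?_
  rw [mul_comm]
  exact Finset.card_biUnion_le_card_mul _ _ _ fun c _ => card_plaquette_le c

/-- A `ℤ/2`-chain with boundary `{(0, 0), (k, 0)}` joins these two points. -/
lemma exists_walk_of_detourChain (k : ℕ) (S : Finset (ℕ × ℕ)) :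
    ∃ w : (SimpleGraph.fromEdgeSet (qEnds '' ((detourChain k S).support : Set QEdge))).Walk
      (0, 0) (k, 0), w.length ≤ k + 4 * S.card := by
  classical
  set G := SimpleGraph.fromEdgeSet (qEnds '' ((detourChain k S).support : Set QEdge)) with hG
  let b : ℕ × ℕ → ZMod 2 := fun v => if G.Reachable (0, 0) v then 1 else 0
  let db : QEdge → ZMod 2 := fun e => b (qTarget e) - b e.2
  have hzero : Finsupp.linearCombination (ZMod 2) db (detourChain k S) = 0 := by
    rw [Finsupp.linearCombination_apply]
    refine Finset.sum_eq_zero fun e he => ?_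
    have hadj : G.Adj e.2 (qTarget e) := by
      rw [hG, SimpleGraph.fromEdgeSet_adj]
      exact ⟨⟨e, he, rfl⟩, ne_qTarget e⟩
    have : G.Reachable (0, 0) (qTarget e) ↔ G.Reachable (0, 0) e.2 :=
      ⟨fun h => h.trans hadj.reachable.symm, fun h => h.trans hadj.reachable⟩
    simp [db, b, this]
  have hsum : Finsupp.linearCombination (ZMod 2) db (detourChain k S) = b (k, 0) - b (0, 0) := by
    simp only [detourChain, map_add, map_sum, Finsupp.linearCombination_single, one_smul]
    have h1 : ∑ a ∈ Finset.range k, db (true, a, 0) = b (k, 0) - b (0, 0) :=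
      Finset.sum_range_sub (fun a => b (a, 0)) k
    have h2 : ∀ c : ℕ × ℕ, ∑ e ∈ plaquette c, db e = 0 := by
      rintro ⟨x, y⟩
      rw [plaquette, Finset.sum_insert (by simp), Finset.sum_insert (by simp),
        Finset.sum_insert (by simp), Finset.sum_singleton]
      simp only [db, qTarget, cond_true, cond_false]
      generalize b (x, y) = p
      generalize b (x + 1, y) = q
      generalize b (x, y + 1) = r
      generalize b (x + 1, y + 1) = s
      revert p q r s
      decide
    rw [h1, Finset.sum_eq_zero fun c _ => h2 c, add_zero]
  have hreach : G.Reachable (0, 0) (k, 0) := by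
    by_contra hne
    rw [hzero] at hsum
    simp [b, hne] at hsum
  obtain ⟨w, hw⟩ := hreach.exists_isPath
  refine ⟨w, le_trans ?_ (card_support_detourChain_le k S)⟩
  rw [← w.length_edges, ← List.toFinset_card_of_nodup hw.isTrail.edges_nodup]
  refine (Finset.card_le_card ?_).trans
    (Finset.card_image_le (s := (detourChain k S).support) (f := qEnds))
  intro e he
  have := w.edges_subset_edgeSet (List.mem_toFinset.1 he)
  rw [hG, SimpleGraph.edgeSet_fromEdgeSet] at this
  obtain ⟨f, hf, rfl⟩ := this.1
  exact Finset.mem_image_of_mem _ hf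

/-- If the set `B` of closed edges connected to the bottom side does not touch the other sides of
`[0, k]²`, then the chain obtained by going around `B` only uses open edges. -/
lemma detourChain_eq_zero {k : ℕ} {C B : Set QEdge} {S : Finset (ℕ × ℕ)}
    (hbot : ∀ a < k, (true, a, 0) ∈ C → (true, a, 0) ∈ B)
    (hstep : ∀ c, ∀ e ∈ plaquette c, ∀ f ∈ plaquette c, e ∈ B → f ∈ C → f ∈ B)
    (hS : ∀ c, c ∈ S ↔ c ∈ squares k ∧ ∃ e ∈ plaquette c, e ∈ B)
    (hleft : ∀ j < k, (false, 0, j) ∉ B) (hright : ∀ j < k, (false, k, j) ∉ B)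
    (htop : ∀ a < k, (true, a, k) ∉ B) {e : QEdge} (he : e ∈ C) :
    detourChain k S e = 0 := by
  rw [detourChain_apply]
  by_cases heB : e ∈ B
  · have hmem : ∀ c ∈ squares k, e ∈ plaquette c → c ∈ S := fun c hc hec =>
      (hS c).2 ⟨hc, e, hec, heB⟩
    have hmem' : ∀ c ∈ S, c ∈ squares k := fun c hc => ((hS c).1 hc).1
    simp only [squares, Finset.mem_product, Finset.mem_range] at hmem hmem'
    obtain ⟨_ | _, a, b⟩ := e
    · have hL : (∑ x ∈ Finset.range k, if (true, x, 0) = (false, a, b) then (1 : ZMod 2) else 0)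
          = 0 := Finset.sum_eq_zero fun x _ => if_neg (by simp)
      have hsplit : ∀ c : ℕ × ℕ, (if (false, a, b) ∈ plaquette c then (1 : ZMod 2) else 0) =
          (if (a, b) = c then 1 else 0) + if (a - 1, b) = c then (if 0 < a then 1 else 0) else 0 := by
        intro c
        simp only [mem_plaquette_false]
        obtain ⟨x, y⟩ := c
        simp only [Prod.mk.injEq]
        split_ifs <;> first | decide | (exfalso; omega)
      rw [hL, Finset.sum_congr rfl fun c _ => hsplit c, Finset.sum_add_distrib,
        Finset.sum_ite_eq, Finset.sum_ite_eq, zero_add]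
      have h1 : (a, b) ∈ S ↔ a < k ∧ b < k :=
        ⟨hmem' _, fun h => hmem _ h (mem_plaquette_false.2 (Or.inl rfl))⟩
      have h2 : 0 < a → ((a - 1, b) ∈ S ↔ a - 1 < k ∧ b < k) := fun ha =>
        ⟨hmem' _, fun h => hmem _ h (mem_plaquette_false.2 (Or.inr ⟨ha, rfl⟩))⟩
      have h3 : ¬ (a = 0 ∧ b < k) := by
        rintro ⟨rfl, hb⟩; exact hleft b hb heB
      have h4 : ¬ (a = k ∧ b < k) := by
        rintro ⟨rfl, hb⟩; exact hright b hb heB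
      rcases Nat.eq_zero_or_pos a with ha | ha
      · have : ¬ (a, b) ∈ S := by rw [h1]; omega
        rw [if_neg this, if_neg (by omega : ¬ 0 < a), ite_self, add_zero]
      · have : (a, b) ∈ S ↔ (a - 1, b) ∈ S := by rw [h1, h2 ha]; omega
        rw [if_pos ha, ← if_congr this rfl rfl]
        exact CharTwo.add_self_eq_zero _
    · have hL : (∑ x ∈ Finset.range k, if (true, x, 0) = (true, a, b) then (1 : ZMod 2) else 0)
          = if a < k ∧ b = 0 then 1 else 0 := by
        have : ∀ x : ℕ, (if (true, x, 0) = (true, a, b) then (1 : ZMod 2) else 0) =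
            if a = x then (if b = 0 then 1 else 0) else 0 := by
          intro x
          simp only [Prod.mk.injEq, true_and]
          split_ifs <;> first | rfl | omega
        rw [Finset.sum_congr rfl fun x _ => this x, Finset.sum_ite_eq]
        simp only [Finset.mem_range, ite_and]
      have hsplit : ∀ c : ℕ × ℕ, (if (true, a, b) ∈ plaquette c then (1 : ZMod 2) else 0) =
          (if (a, b) = c then 1 else 0) + if (a, b - 1) = c then (if 0 < b then 1 else 0) else 0 := by
        intro c
        simp only [mem_plaquette_true]
        obtain ⟨x, y⟩ := c
        simp only [Prod.mk.injEq]
        split_ifs <;> first | decide | (exfalso; omega)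
      rw [hL, Finset.sum_congr rfl fun c _ => hsplit c, Finset.sum_add_distrib,
        Finset.sum_ite_eq, Finset.sum_ite_eq]
      have h1 : (a, b) ∈ S ↔ a < k ∧ b < k :=
        ⟨hmem' _, fun h => hmem _ h (mem_plaquette_true.2 (Or.inl rfl))⟩
      have h2 : 0 < b → ((a, b - 1) ∈ S ↔ a < k ∧ b - 1 < k) := fun hb =>
        ⟨hmem' _, fun h => hmem _ h (mem_plaquette_true.2 (Or.inr ⟨hb, rfl⟩))⟩
      have h3 : ¬ (a < k ∧ b = k) := by
        rintro ⟨ha, rfl⟩; exact htop a ha heB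
      rcases Nat.eq_zero_or_pos b with hb | hb
      · have : (a, b) ∈ S ↔ a < k ∧ b = 0 := by rw [h1]; omega
        rw [if_congr this rfl rfl, if_neg (by omega : ¬ 0 < b), ite_self, add_zero]
        exact CharTwo.add_self_eq_zero _
      · have : (a, b) ∈ S ↔ (a, b - 1) ∈ S := by rw [h1, h2 hb]; omega
        rw [if_pos hb, ← if_congr this rfl rfl, if_neg (by omega), zero_add]
        exact CharTwo.add_self_eq_zero _
  · rw [Finset.sum_eq_zero, Finset.sum_eq_zero, add_zero]
    · intro c hc
      refine if_neg fun hec => heB ?_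
      obtain ⟨-, f, hf, hfB⟩ := (hS c).1 hc
      exact hstep c f hf e hec hfB he
    · intro a ha
      refine if_neg ?_
      rintro rfl
      exact heB (hbot a (Finset.mem_range.1 ha) he)

end Quadrant

section ClosedClusters

/-- The graph on the edges of the quadrant in which two edges of `C` are adjacent if they lie on a
common unit square. -/
def starGraph (C : Set QEdge) : SimpleGraph QEdge where
  Adj e f := e ≠ f ∧ e ∈ C ∧ f ∈ C ∧ ∃ c, e ∈ plaquette c ∧ f ∈ plaquette c
  symm := ⟨fun _ _ ⟨hne, he, hf, c, hec, hfc⟩ => ⟨hne.symm, hf, he, c, hfc, hec⟩⟩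
  loopless := ⟨fun _ h => h.1 rfl⟩

/-- The edges of `C` in the same cluster of `starGraph C` as some edge of the bottom side. -/
def bottomClusters (C : Set QEdge) : Set QEdge :=
  {e | e ∈ C ∧ ∃ a, (starGraph C).Reachable e (true, a, 0)}

lemma mem_bottomClusters_of_mem_plaquette {C : Set QEdge} (c : ℕ × ℕ) (e : QEdge)
    (he : e ∈ plaquette c) (f : QEdge) (hf : f ∈ plaquette c) (heB : e ∈ bottomClusters C)
    (hfC : f ∈ C) : f ∈ bottomClusters C := by
  obtain ⟨heC, a, ha⟩ := heB
  refine ⟨hfC, a, ?_⟩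
  by_cases hef : e = f
  · exact hef ▸ ha
  · have hadj : (starGraph C).Adj f e := ⟨Ne.symm hef, hfC, heC, c, hf, he⟩
    exact hadj.reachable.trans ha

/-- The number of steps needed to reach the bottom side from an edge. -/
def qHeight (e : QEdge) : ℕ := bif e.1 then e.2.2 else e.2.2 + 1

lemma qHeight_of_mem_plaquette {c : ℕ × ℕ} {e : QEdge} (he : e ∈ plaquette c) :
    c.2 ≤ qHeight e ∧ qHeight e ≤ c.2 + 1 := by
  simp only [plaquette, Finset.mem_insert, Finset.mem_singleton] at he
  rcases he with rfl | rfl | rfl | rfl <;> simp [qHeight]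

lemma qHeight_le_length {C : Set QEdge} {e f : QEdge} (w : (starGraph C).Walk e f) :
    qHeight e ≤ qHeight f + w.length := by
  induction w with
  | nil => simp
  | cons h w ih =>
    obtain ⟨c, hec, hfc⟩ := h.2.2.2
    have h1 := qHeight_of_mem_plaquette hec
    have h2 := qHeight_of_mem_plaquette hfc
    rw [SimpleGraph.Walk.length_cons]
    omega

/-- The edges lying on a common unit square with `e`. -/
def starNeighbors (e : QEdge) : Finset QEdge :=
  plaquette e.2 ∪ plaquette (bif e.1 then (e.2.1, e.2.2 - 1) else (e.2.1 - 1, e.2.2))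

lemma card_starNeighbors_le (e : QEdge) : (starNeighbors e).card ≤ 8 :=
  (Finset.card_union_le _ _).trans (add_le_add (card_plaquette_le _) (card_plaquette_le _))

lemma mem_starNeighbors {c : ℕ × ℕ} {e f : QEdge} (he : e ∈ plaquette c) (hf : f ∈ plaquette c) :
    f ∈ starNeighbors e := by
  rw [starNeighbors, Finset.mem_union]
  obtain ⟨_ | _, a, b⟩ := e
  · rcases mem_plaquette_false.1 he with rfl | ⟨-, rfl⟩
    exacts [Or.inl hf, Or.inr hf]
  · rcases mem_plaquette_true.1 he with rfl | ⟨-, rfl⟩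
    exacts [Or.inl hf, Or.inr hf]

/-- The sequences of `n + 1` edges starting from `e` in which any two consecutive edges lie on a
common unit square. -/
def starPaths : ℕ → QEdge → Finset (List QEdge)
  | 0, e => {[e]}
  | n + 1, e => (starNeighbors e).biUnion fun f => (starPaths n f).image (List.cons e)

lemma card_starPaths_le (n : ℕ) (e : QEdge) : (starPaths n e).card ≤ 8 ^ n := by
  induction n generalizing e with
  | zero => simp [starPaths]
  | succ n ih =>
    rw [starPaths, pow_succ']
    refine (Finset.card_biUnion_le_card_mul _ _ (8 ^ n) fun f _ =>
      Finset.card_image_le.trans (ih f)).trans ?_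
    exact Nat.mul_le_mul_right _ (card_starNeighbors_le e)

lemma length_of_mem_starPaths {n : ℕ} {e : QEdge} {l : List QEdge} (hl : l ∈ starPaths n e) :
    l.length = n + 1 := by
  induction n generalizing e l with
  | zero =>
    rw [starPaths, Finset.mem_singleton] at hl
    simp [hl]
  | succ n ih =>
    simp only [starPaths, Finset.mem_biUnion, Finset.mem_image] at hl
    obtain ⟨f, -, l', hl', rfl⟩ := hl
    simp [ih hl']

lemma support_mem_starPaths {C : Set QEdge} {e f : QEdge} (w : (starGraph C).Walk e f) :
    w.support ∈ starPaths w.length e := by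
  induction w with
  | nil => simp [starPaths]
  | cons h w ih =>
    obtain ⟨c, hec, hfc⟩ := h.2.2.2
    rw [SimpleGraph.Walk.length_cons, starPaths, Finset.mem_biUnion]
    exact ⟨_, mem_starNeighbors hec hfc, Finset.mem_image_of_mem _ ih⟩

lemma mem_of_mem_support {C : Set QEdge} {e f : QEdge} (he : e ∈ C) (w : (starGraph C).Walk e f) :
    ∀ g ∈ w.support, g ∈ C := by
  induction w with
  | nil => simpa using he
  | cons h w ih =>
    intro g hg
    rw [SimpleGraph.Walk.support_cons, List.mem_cons] at hg
    rcases hg with rfl | hg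
    exacts [he, ih h.2.2.1 g hg]

lemma exists_starPath_of_mem_bottomClusters {C : Set QEdge} {e : QEdge}
    (he : e ∈ bottomClusters C) :
    ∃ l ∈ starPaths (qHeight e) e, l.Nodup ∧ ∀ f ∈ l, f ∈ C := by
  obtain ⟨heC, a, ha⟩ := he
  obtain ⟨w, hw⟩ := ha.exists_isPath
  have hlen : (w.take (qHeight e)).length = qHeight e := by
    rw [SimpleGraph.Walk.take_length]
    have := qHeight_le_length w
    simp only [qHeight, cond_true, zero_add] at this ⊢
    omega
  refine ⟨(w.take (qHeight e)).support, ?_, (hw.take _).support_nodup, mem_of_mem_support heC _⟩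
  have := support_mem_starPaths (w.take (qHeight e))
  rwa [hlen] at this

end ClosedClusters

section Probability

variable {ι : Type*} {p : ℝ} {P : Measure (ι → Bool)} {φ : QEdge → ι}

lemma measure_forall_eq_false (hP : IsProductBernoulli p P) (hφ : φ.Injective)
    (s : Finset QEdge) :
    P {ω | ∀ e ∈ s, ω (φ e) = false} = ENNReal.ofReal (1 - p) ^ s.card := by
  classical
  have h := hP.2 (s.image φ) (fun _ => false)
  simp only [Finset.forall_mem_image] at h
  rw [h]
  simp [Finset.card_image_of_injective _ hφ]

/-- The event that some self-avoiding path of `n + 1` closed edges in the star graph starts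
from `e`, where `φ` identifies the edges of the quadrant with some edges of the lattice. -/
def chainEvent (φ : QEdge → ι) (e : QEdge) (n : ℕ) : Set (ι → Bool) :=
  {ω | ∃ l ∈ starPaths n e, l.Nodup ∧ ∀ f ∈ l, ω (φ f) = false}

lemma chainEvent_eq (e : QEdge) (n : ℕ) : chainEvent φ e n =
    ⋃ l ∈ (starPaths n e).filter List.Nodup, {ω | ∀ f ∈ l.toFinset, ω (φ f) = false} := by
  ext ω
  simp only [chainEvent, Set.mem_ofPred_eq, Set.mem_iUnion, Finset.mem_filter, List.mem_toFinset,
    exists_prop, and_assoc]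

lemma measurableSet_chainEvent (e : QEdge) (n : ℕ) : MeasurableSet (chainEvent φ e n) := by
  rw [chainEvent_eq]
  refine Finset.measurableSet_biUnion _ fun l _ => ?_
  have : {ω : ι → Bool | ∀ f ∈ l.toFinset, ω (φ f) = false} =
      ⋂ f ∈ l.toFinset, (fun ω : ι → Bool => ω (φ f)) ⁻¹' {false} := by
    ext ω; simp
  rw [this]
  exact Finset.measurableSet_biInter _ fun f _ =>
    measurable_pi_apply _ (MeasurableSet.singleton _)

lemma measure_chainEvent_le (hP : IsProductBernoulli p P) (hφ : φ.Injective)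
    (hp : 16 * ENNReal.ofReal (1 - p) ≤ 1) (e : QEdge) (n : ℕ) :
    P (chainEvent φ e n) ≤ ENNReal.ofReal (1 - p) * 2⁻¹ ^ n := by
  set q := ENNReal.ofReal (1 - p)
  have hq : 8 * q ≤ 2⁻¹ := by
    rw [ENNReal.le_inv_iff_mul_le]
    calc 8 * q * 2 = 16 * q := by ring
      _ ≤ 1 := hp
  rw [chainEvent_eq]
  refine (measure_biUnion_finset_le _ _).trans ?_
  calc ∑ l ∈ (starPaths n e).filter List.Nodup, P {ω | ∀ f ∈ l.toFinset, ω (φ f) = false}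
      ≤ ∑ l ∈ (starPaths n e).filter List.Nodup, q ^ (n + 1) := by
        refine Finset.sum_le_sum fun l hl => ?_
        rw [Finset.mem_filter] at hl
        rw [measure_forall_eq_false hP hφ, List.toFinset_card_of_nodup hl.2,
          length_of_mem_starPaths hl.1]
    _ ≤ (8 : ℝ≥0∞) ^ n * q ^ (n + 1) := by
        rw [Finset.sum_const, nsmul_eq_mul]
        gcongr
        exact_mod_cast (Finset.card_filter_le _ _).trans (card_starPaths_le n e)
    _ = q * (8 * q) ^ n := by ring
    _ ≤ q * 2⁻¹ ^ n := by gcongr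

lemma sum_two_inv_pow_le (k : ℕ) : ∑ j ∈ Finset.range k, (2⁻¹ : ℝ≥0∞) ^ j ≤ 2 := by
  refine (ENNReal.sum_le_tsum _).trans ?_
  rw [ENNReal.tsum_geometric, ENNReal.one_sub_inv_two, inv_inv]

/-- An upper bound for the number of squares of `[0, k]²` that touch a closed cluster coming from
the bottom side. -/
noncomputable def squareCount (φ : QEdge → ι) (k : ℕ) (ω : ι → Bool) : ℝ≥0∞ :=
  ∑ c ∈ squares k, ∑ e ∈ plaquette c, (chainEvent φ e (qHeight e)).indicator 1 ω

lemma measurable_squareCount (k : ℕ) : Measurable (squareCount φ k) :=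
  Finset.measurable_sum _ fun _ _ => Finset.measurable_sum _ fun _ _ =>
    measurable_one.indicator (measurableSet_chainEvent _ _)

lemma lintegral_squareCount_le (hP : IsProductBernoulli p P) (hφ : φ.Injective)
    (hp : 16 * ENNReal.ofReal (1 - p) ≤ 1) (k : ℕ) :
    ∫⁻ ω, squareCount φ k ω ∂P ≤ 8 * k * ENNReal.ofReal (1 - p) := by
  set q := ENNReal.ofReal (1 - p)
  have hmeas : ∀ e : QEdge, Measurable ((chainEvent φ e (qHeight e)).indicator
      (1 : (ι → Bool) → ℝ≥0∞)) := fun e =>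
    measurable_one.indicator (measurableSet_chainEvent _ _)
  unfold squareCount
  rw [lintegral_finsetSum _ fun c _ => Finset.measurable_sum _ fun e _ => hmeas e]
  calc ∑ c ∈ squares k, ∫⁻ ω, ∑ e ∈ plaquette c,
          (chainEvent φ e (qHeight e)).indicator 1 ω ∂P
      ≤ ∑ c ∈ squares k, 4 * (q * 2⁻¹ ^ c.2) := by
        refine Finset.sum_le_sum fun c _ => ?_
        rw [lintegral_finsetSum _ fun e _ => hmeas e]
        calc _ ≤ ∑ e ∈ plaquette c, q * 2⁻¹ ^ c.2 := by
              refine Finset.sum_le_sum fun e he => ?_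
              rw [lintegral_indicator_one (measurableSet_chainEvent _ _)]
              refine (measure_chainEvent_le hP hφ hp e _).trans ?_
              exact mul_le_mul' le_rfl
                (pow_le_pow_right_of_le_one' (ENNReal.inv_le_one.2 one_le_two) (qHeight_of_mem_plaquette he).1)
          _ ≤ _ := by
              rw [Finset.sum_const, nsmul_eq_mul]
              gcongr
              exact_mod_cast card_plaquette_le c
    _ = 4 * k * q * ∑ b ∈ Finset.range k, 2⁻¹ ^ b := by
        rw [squares, Finset.sum_product]
        simp only [Finset.sum_const, Finset.card_range, nsmul_eq_mul, Finset.mul_sum]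
        exact Finset.sum_congr rfl fun b _ => by ring
    _ ≤ 4 * k * q * 2 := by gcongr; exact sum_two_inv_pow_le k
    _ = 8 * k * q := by ring

/-- The event that a closed cluster coming from the bottom side of `[0, k]²` touches another side,
or that such clusters touch at least `k / m` unit squares. -/
def badEvent (φ : QEdge → ι) (m k : ℕ) : Set (ι → Bool) :=
  (⋃ j ∈ Finset.range k, chainEvent φ (false, 0, j) (j + 1)) ∪
    (⋃ j ∈ Finset.range k, chainEvent φ (false, k, j) (j + 1)) ∪
    (⋃ a ∈ Finset.range k, chainEvent φ (true, a, k) k) ∪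
    {ω | (k : ℝ≥0∞) ≤ m * squareCount φ k ω}

lemma measure_badEvent_le (hP : IsProductBernoulli p P) (hφ : φ.Injective) {m k : ℕ}
    (hm : 0 < m) (hk : 0 < k) (hp : 32 * m * ENNReal.ofReal (1 - p) ≤ 1) :
    P (badEvent φ m k) ≤ 2⁻¹ := by
  set q := ENNReal.ofReal (1 - p) with hq
  have hm1 : (1 : ℝ≥0∞) ≤ m := by exact_mod_cast hm
  have hp' : 16 * q ≤ 1 := by
    refine le_trans ?_ hp
    calc 16 * q ≤ 32 * 1 * q := by gcongr; norm_num
      _ ≤ 32 * m * q := by gcongr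
  have key : ∀ (f : ℕ → QEdge) (g : ℕ → ℕ), (∀ j < k, j ≤ g j) →
      P (⋃ j ∈ Finset.range k, chainEvent φ (f j) (g j)) ≤ 2 * q := by
    intro f g hg
    refine (measure_biUnion_finset_le _ _).trans ?_
    calc ∑ j ∈ Finset.range k, P (chainEvent φ (f j) (g j))
        ≤ ∑ j ∈ Finset.range k, q * 2⁻¹ ^ j := by
          refine Finset.sum_le_sum fun j hj => (measure_chainEvent_le hP hφ hp' _ _).trans ?_
          exact mul_le_mul' le_rfl
            (pow_le_pow_right_of_le_one' (ENNReal.inv_le_one.2 one_le_two) (hg j (Finset.mem_range.1 hj)))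
      _ ≤ q * 2 := by
          rw [← Finset.mul_sum]
          gcongr
          exact sum_two_inv_pow_le k
      _ = 2 * q := mul_comm _ _
  have h1 := key (fun j => (false, 0, j)) (fun j => j + 1) (fun j _ => Nat.le_succ j)
  have h2 := key (fun j => (false, k, j)) (fun j => j + 1) (fun j _ => Nat.le_succ j)
  have h3 := key (fun a => (true, a, k)) (fun _ => k) (fun j hj => hj.le)
  have h4 : P {ω | (k : ℝ≥0∞) ≤ m * squareCount φ k ω} ≤ 8 * m * q := by
    have hk0 : (k : ℝ≥0∞) ≠ 0 := by exact_mod_cast hk.ne'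
    refine (meas_ge_le_lintegral_div ((measurable_squareCount k).const_mul _).aemeasurable hk0
      (ENNReal.natCast_ne_top k)).trans ?_
    rw [lintegral_const_mul _ (measurable_squareCount k)]
    refine ENNReal.div_le_of_le_mul ?_
    calc _ ≤ (m : ℝ≥0∞) * (8 * k * q) := by
          gcongr; exact lintegral_squareCount_le hP hφ hp' k
      _ = 8 * m * q * k := by ring
  calc P (badEvent φ m k) ≤ 2 * q + 2 * q + 2 * q + 8 * m * q :=
        (measure_union_le _ _).trans (add_le_add ((measure_union_le _ _).trans (add_le_add
          ((measure_union_le _ _).trans (add_le_add h1 h2)) h3)) h4)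
    _ = 6 * 1 * q + 8 * m * q := by ring
    _ ≤ 8 * m * q + 8 * m * q := by gcongr; norm_num
    _ ≤ 2⁻¹ := by
        rw [ENNReal.le_inv_iff_mul_le]
        calc _ = 32 * m * q := by ring
          _ ≤ 1 := hp

/-- Infinitely many of the complements of the events `badEvent φ m k` occur with probability at
least one half. -/
lemma measure_eventually_badEvent_le (hP : IsProductBernoulli p P) (hφ : φ.Injective) {m : ℕ}
    (hm : 0 < m) (hp : 32 * m * ENNReal.ofReal (1 - p) ≤ 1) :
    P {ω | ∀ᶠ k in atTop, ω ∈ badEvent φ m k} ≤ 2⁻¹ := by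
  have heq : {ω | ∀ᶠ k in atTop, ω ∈ badEvent φ m k} =
      ⋃ n : ℕ, {ω | ∀ k ≥ n, ω ∈ badEvent φ m k} := by
    ext ω; simp [eventually_atTop]
  have hmono : Monotone fun n : ℕ => {ω | ∀ k ≥ n, ω ∈ badEvent φ m k} :=
    fun a b hab ω hω k hk => hω k (hab.trans hk)
  rw [heq, hmono.measure_iUnion]
  refine iSup_le fun n => ?_
  refine (measure_mono fun ω hω => ?_).trans
    (measure_badEvent_le hP hφ hm (Nat.succ_pos n) hp)
  exact hω (n + 1) (Nat.le_succ n)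

lemma exists_isProductBernoulli (ι : Type*) (hp0 : 0 ≤ p) (hp1 : p ≤ 1) :
    ∃ P : Measure (ι → Bool), IsProductBernoulli p P := by
  let ν : Measure Bool := ENNReal.ofReal p • Measure.dirac true +
    ENNReal.ofReal (1 - p) • Measure.dirac false
  have hν : IsProbabilityMeasure ν := ⟨by
    simp only [ν, Measure.add_apply, Measure.smul_apply, measure_univ, smul_eq_mul, mul_one]
    rw [← ENNReal.ofReal_add hp0 (by linarith)]
    simp⟩
  refine ⟨Measure.infinitePi fun _ : ι => ν, inferInstance, fun s η => ?_⟩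
  have heq : {ω : ι → Bool | ∀ e ∈ s, ω e = η e} = Set.pi s fun e => {η e} := by
    ext ω; simp [Set.mem_pi]
  rw [heq, Measure.infinitePi_pi _ fun _ _ => MeasurableSet.singleton _]
  refine Finset.prod_congr rfl fun e _ => ?_
  cases η e <;> simp [ν]

end Probability

section Embedding

variable {d : ℕ}

/-- The embedding of the quadrant in the coordinate plane of `ℤ^d` spanned by the directions
`i` and `j`. -/
def planeEmb (i j : Fin d) (v : ℕ × ℕ) : Vert d :=
  fun m => if m = i then (v.1 : ℤ) else if m = j then (v.2 : ℤ) else 0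

lemma planeEmb_injective {i j : Fin d} (hij : i ≠ j) : (planeEmb i j).Injective := by
  intro v w h
  have h1 := congrFun h i
  have h2 := congrFun h j
  simp only [planeEmb, if_true, if_neg hij.symm, Nat.cast_inj] at h1 h2
  exact Prod.ext h1 h2

lemma planeEmb_axis {i j : Fin d} (k : ℕ) : planeEmb i j (k, 0) = k • Pi.single i (1 : ℤ) := by
  ext m
  by_cases hm : m = i
  · subst hm; simp [planeEmb]
  · simp [planeEmb, hm]

lemma planeEmb_zero {i j : Fin d} : planeEmb i j (0, 0) = 0 := by
  rw [planeEmb_axis, zero_smul]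

lemma adj_planeEmb {i j : Fin d} (hij : i ≠ j) (e : QEdge) :
    adj (planeEmb i j e.2) (planeEmb i j (qTarget e)) := by
  unfold adj
  obtain ⟨_ | _, a, b⟩ := e
  · rw [Finset.sum_eq_single j]
    · simp [planeEmb, qTarget, hij.symm]
    · intro m _ hm
      simp [planeEmb, qTarget, hm]
    · simp
  · rw [Finset.sum_eq_single i]
    · simp [planeEmb, qTarget]
    · intro m _ hm
      simp [planeEmb, qTarget, hm]
    · simp

/-- The edge of `ℤ^d` corresponding to an edge of the quadrant. -/
def edgeEmb {i j : Fin d} (hij : i ≠ j) (e : QEdge) : EdgeT d :=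
  ⟨s(planeEmb i j e.2, planeEmb i j (qTarget e)), _, _, adj_planeEmb hij e, rfl⟩

lemma qEnds_injective : Function.Injective qEnds := by
  rintro ⟨x, a, b⟩ ⟨y, a', b'⟩ h
  cases x <;> cases y <;>
  · simp only [qEnds, qTarget, cond_true, cond_false, Sym2.eq_iff, Prod.mk.injEq] at h ⊢
    simp only [true_and, reduceCtorEq, false_and]
    omega

lemma edgeEmb_injective {i j : Fin d} (hij : i ≠ j) : (edgeEmb hij).Injective := by
  intro e f h
  have h' : Sym2.map (planeEmb i j) (qEnds e) = Sym2.map (planeEmb i j) (qEnds f) :=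
    congrArg Subtype.val h
  exact qEnds_injective (Sym2.map.injective (planeEmb_injective hij) h')

lemma edgeOpen_planeEmb {i j : Fin d} (hij : i ≠ j) {ω : Config d} {e : QEdge}
    (he : ω (edgeEmb hij e) = true) : edgeOpen ω (planeEmb i j e.2) (planeEmb i j (qTarget e)) :=
  ⟨adj_planeEmb hij e, he⟩

lemma mem_chainEvent_of_mem_bottomClusters {ι : Type*} {φ : QEdge → ι} {ω : ι → Bool} {e : QEdge}
    (he : e ∈ bottomClusters {f | ω (φ f) = false}) : ω ∈ chainEvent φ e (qHeight e) :=
  exists_starPath_of_mem_bottomClusters he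

/-- Outside the bad event, the chemical distance along a coordinate axis is almost minimal. -/
lemma chemDist_axis_le {i j : Fin d} (hij : i ≠ j) {ω : Config d} {m k : ℕ}
    (hω : ω ∉ badEvent (edgeEmb hij) m k) :
    ∃ s : ℕ, m * s ≤ k ∧ chemDist ω 0 (k • Pi.single i (1 : ℤ)) ≤ (k + 4 * s : ℕ) := by
  classical
  set φ := edgeEmb hij with hφ
  set C : Set QEdge := {e | ω (φ e) = false} with hC
  set B := bottomClusters C with hB
  set S := (squares k).filter fun c => ∃ e ∈ plaquette c, e ∈ B with hS
  simp only [badEvent, Set.mem_union, Set.mem_iUnion, Finset.mem_range, exists_prop, not_or,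
    not_exists, not_and, Set.mem_ofPred_eq, not_le] at hω
  obtain ⟨⟨⟨hleft, hright⟩, htop⟩, hcount⟩ := hω
  have hSle : (S.card : ℝ≥0∞) ≤ squareCount φ k ω := by
    rw [hS, Finset.card_filter, squareCount]
    push_cast
    refine Finset.sum_le_sum fun c _ => ?_
    split_ifs with hc
    · obtain ⟨e, he, heB⟩ := hc
      refine le_trans ?_ (Finset.single_le_sum (fun _ _ => zero_le) he)
      rw [Set.indicator_of_mem (mem_chainEvent_of_mem_bottomClusters heB)]
      simp
    · exact zero_le
  refine ⟨S.card, ?_, ?_⟩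
  · have : (m : ℝ≥0∞) * S.card < k := lt_of_le_of_lt (by gcongr) hcount
    exact_mod_cast this.le
  · have hzero : ∀ e ∈ C, detourChain k S e = 0 := fun e he =>
      detourChain_eq_zero (B := B) (fun a _ ha => ⟨ha, a, SimpleGraph.Reachable.rfl⟩)
        (fun c e he f hf => mem_bottomClusters_of_mem_plaquette c e he f hf)
        (fun c => by simp [hS])
        (fun j hj h => hleft j hj (mem_chainEvent_of_mem_bottomClusters h))
        (fun j hj h => hright j hj (mem_chainEvent_of_mem_bottomClusters h))
        (fun a ha h => htop a ha (mem_chainEvent_of_mem_bottomClusters h)) he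
    obtain ⟨w, hw⟩ := exists_walk_of_detourChain k S
    have hdist := chemDist_le_of_walk (ω := ω) (planeEmb i j) (fun a b hab => by
      rw [SimpleGraph.fromEdgeSet_adj] at hab
      obtain ⟨⟨e, he, hab⟩, -⟩ := hab
      have hopen : edgeOpen ω (planeEmb i j e.2) (planeEmb i j (qTarget e)) := by
        refine edgeOpen_planeEmb hij ?_
        by_contra hclosed
        exact Finsupp.mem_support_iff.1 he (hzero e (by simpa [hC] using hclosed))
      rcases Sym2.eq_iff.1 hab with ⟨rfl, rfl⟩ | ⟨rfl, rfl⟩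
      exacts [hopen, edgeOpen_symm hopen]) w
    rw [planeEmb_zero, planeEmb_axis] at hdist
    exact hdist.trans (by exact_mod_cast hw)

/-- The event that, along the axis `i`, infinitely many points are at chemical distance at most
`1 + 4 / m` times their distance to the origin. -/
def GoodAxis (ω : Config d) (i : Fin d) (m : ℕ) : Prop :=
  ∃ᶠ k : ℕ in atTop, Conn ω 0 (k • Pi.single i (1 : ℤ)) ∧
    m * chemDistR ω 0 (k • Pi.single i (1 : ℤ)) ≤ (m + 4) * k

lemma goodAxis_of_frequently {i j : Fin d} (hij : i ≠ j) {ω : Config d} {m : ℕ}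
    (hω : ¬ ∀ᶠ k in atTop, ω ∈ badEvent (edgeEmb hij) m k) : GoodAxis ω i m := by
  rw [not_eventually] at hω
  refine hω.mono fun k hk => ?_
  obtain ⟨s, hs, hdist⟩ := chemDist_axis_le hij hk
  refine ⟨ne_top_of_le_ne_top (ENat.natCast_ne_top _) hdist, ?_⟩
  have h1 : (chemDist ω 0 (k • Pi.single i (1 : ℤ))).toNat ≤ k + 4 * s :=
    ENat.toNat_le_of_le_natCast hdist
  have h2 : m * (chemDist ω 0 (k • Pi.single i (1 : ℤ))).toNat ≤ (m + 4) * k := by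
    calc _ ≤ m * (k + 4 * s) := Nat.mul_le_mul_left _ h1
      _ = m * k + 4 * (m * s) := by ring
      _ ≤ m * k + 4 * k := by omega
      _ = _ := by ring
  unfold chemDistR
  exact_mod_cast h2

lemma GoodAxis.infCluster {i : Fin d} {ω : Config d} {m : ℕ} (h : GoodAxis ω i m) :
    InfCluster ω 0 := by
  have hinf := Nat.frequently_atTop_iff_infinite.1 h
  refine (hinf.image (f := fun k : ℕ => (k • Pi.single i (1 : ℤ) : Vert d)) ?_).mono ?_
  · intro a _ b _ hab
    have := congrFun hab i
    simpa using this
  · rintro _ ⟨k, hk, rfl⟩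
    exact hk.1

lemma measure_not_goodAxis_le (hd : 2 ≤ d) {p : ℝ} {P : Measure (Config d)}
    (hP : IsProductBernoulli p P) (i : Fin d) {m : ℕ} (hm : 0 < m)
    (hp : 1 - 1 / (32 * m) ≤ p) : P {ω | ¬ GoodAxis ω i m} ≤ 2⁻¹ := by
  have : Nontrivial (Fin d) := Fin.nontrivial_iff_two_le.2 hd
  obtain ⟨j, hj⟩ := exists_ne i
  refine (measure_mono fun ω hω => ?_).trans
    (measure_eventually_badEvent_le hP (edgeEmb_injective hj.symm) hm ?_)
  · by_contra hne
    exact hω (goodAxis_of_frequently hj.symm hne)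
  · have h1 : 32 * (m : ℝ) * (1 - p) ≤ 1 := by
      have hm' : (0 : ℝ) < 32 * m := by positivity
      calc 32 * (m : ℝ) * (1 - p) ≤ 32 * m * (1 / (32 * m)) := by gcongr; linarith
        _ = 1 := by field_simp
    calc 32 * (m : ℝ≥0∞) * ENNReal.ofReal (1 - p) = ENNReal.ofReal (32 * m * (1 - p)) := by
          rw [ENNReal.ofReal_mul (by positivity), ENNReal.ofReal_mul (by norm_num),
            ENNReal.ofReal_natCast, ENNReal.ofReal_ofNat]
      _ ≤ 1 := ENNReal.ofReal_le_one.2 h1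

lemma pc_le (hd : 2 ≤ d) : pc d ≤ 31 / 32 := by
  refine csInf_le ⟨0, fun p hp => hp.1.1⟩ ⟨by norm_num, fun P hP => ?_⟩
  have := hP.1
  by_contra hzero
  rw [not_lt, nonpos_iff_eq_zero] at hzero
  have hbad := measure_not_goodAxis_le hd hP ⟨0, by omega⟩ one_pos (by norm_num)
  have hle : P Set.univ ≤ P {ω | InfCluster ω 0} + P {ω | ¬ GoodAxis ω ⟨0, by omega⟩ 1} := by
    refine (measure_mono fun ω _ => ?_).trans (measure_union_le _ _)
    by_cases h : GoodAxis ω ⟨0, by omega⟩ 1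
    exacts [Or.inl h.infCluster, Or.inr h]
  rw [hzero, zero_add, measure_univ] at hle
  exact absurd (hle.trans hbad) (by simp)

end Embedding

section TimeConstant

variable {d : ℕ} {μ : (Fin d → ℝ) → ℝ}

lemma IsNorm.map_zero (hμ : IsNorm μ) : μ 0 = 0 := (hμ.eq_zero_iff 0).2 rfl

lemma IsNorm.nonneg (hμ : IsNorm μ) (x : Fin d → ℝ) : 0 ≤ μ x := by
  have h1 := hμ.add_le x ((-1 : ℝ) • x)
  rw [hμ.smul, show x + (-1 : ℝ) • x = 0 by simp, hμ.map_zero] at h1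
  norm_num at h1
  linarith

lemma nrm1_nonneg (x : Fin d → ℝ) : 0 ≤ nrm1 x := Finset.sum_nonneg fun _ _ => abs_nonneg _

lemma IsNorm.le_mul_nrm1 (hμ : IsNorm μ) {c : ℝ} (hc : ∀ i, μ (Pi.single i 1) ≤ c)
    (x : Fin d → ℝ) : μ x ≤ c * nrm1 x := by
  have hx : x = ∑ i, x i • (Pi.single i 1 : Fin d → ℝ) := by
    ext m
    simp [Finset.sum_apply, Pi.single_apply]
  calc μ x = μ (∑ i, x i • (Pi.single i 1 : Fin d → ℝ)) := by rw [← hx]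
    _ ≤ ∑ i, μ (x i • (Pi.single i 1 : Fin d → ℝ)) :=
        Finset.le_sum_of_subadditive μ hμ.map_zero.le hμ.add_le _ _
    _ ≤ ∑ i, c * |x i| := by
        refine Finset.sum_le_sum fun i _ => ?_
        rw [hμ.smul, mul_comm]
        exact mul_le_mul_of_nonneg_right (hc i) (abs_nonneg _)
    _ = c * nrm1 x := by rw [nrm1, Finset.mul_sum]

/-- A norm dominating the `ℓ¹` norm on `ℤ^d` dominates it everywhere. -/
lemma IsNorm.nrm1_le (hμ : IsNorm μ) (hint : ∀ u : Vert d, nrm1 (toR u) ≤ μ (toR u))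
    (x : Fin d → ℝ) : nrm1 x ≤ μ x := by
  obtain ⟨c, hc⟩ : ∃ c, ∀ i, μ (Pi.single i 1) ≤ c := by
    obtain ⟨c, hc⟩ := (Set.finite_range fun i : Fin d => μ (Pi.single i 1)).bddAbove
    exact ⟨c, fun i => hc ⟨i, rfl⟩⟩
  have hbound : ∀ n : ℕ, (nrm1 x - μ x) * n ≤ d + |c| * d := by
    intro n
    let u : Vert d := fun i => ⌊n * x i⌋
    let r : Fin d → ℝ := fun i => Int.fract (n * x i)
    have hr : nrm1 r ≤ d := by
      calc nrm1 r ≤ ∑ _i : Fin d, (1 : ℝ) := by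
            refine Finset.sum_le_sum fun i _ => ?_
            rw [abs_of_nonneg (Int.fract_nonneg _)]
            exact (Int.fract_lt_one _).le
        _ = d := by simp
    have hux : toR u = (n : ℝ) • x + (-1 : ℝ) • r := by
      ext i
      simp only [toR, u, r, Pi.add_apply, Pi.smul_apply, smul_eq_mul, Int.fract]
      ring
    have h1 : μ (toR u) ≤ n * μ x + |c| * d := by
      rw [hux]
      refine (hμ.add_le _ _).trans ?_
      rw [hμ.smul, hμ.smul]
      have h2 := hμ.le_mul_nrm1 (fun i => (hc i).trans (le_abs_self c)) r
      have h3 : |c| * nrm1 r ≤ |c| * d := mul_le_mul_of_nonneg_left hr (abs_nonneg c)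
      rw [Nat.abs_cast, abs_neg, abs_one, one_mul]
      linarith
    have h4 : n * nrm1 x ≤ nrm1 (toR u) + nrm1 r := by
      simp only [nrm1]
      rw [Finset.mul_sum, ← Finset.sum_add_distrib]
      refine Finset.sum_le_sum fun i _ => ?_
      have : (n : ℝ) * x i = toR u i + r i := (Int.floor_add_fract _).symm
      calc (n : ℝ) * |x i| = |n * x i| := by rw [abs_mul, Nat.abs_cast]
        _ ≤ |toR u i| + |r i| := by rw [this]; exact abs_add_le _ _
    have h5 := hint u
    linarith
  by_contra hlt
  rw [not_le] at hlt
  obtain ⟨n, hn⟩ := exists_nat_gt ((d + |c| * d) / (nrm1 x - μ x))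
  rw [div_lt_iff₀ (sub_pos.2 hlt)] at hn
  linarith [hbound n]

lemma exists_goodAxis (hd : 2 ≤ d) {p : ℝ} (hμ : TimeConstant d p μ) {m : ℕ} (hm : 0 < m)
    (hp : 1 - 1 / (32 * m) ≤ p) (hp1 : p ≤ 1) (i : Fin d) :
    ∃ ω : Config d, GoodAxis ω i m ∧ ∀ u : Vert d, u ≠ 0 →
      {k : ℕ | 0 < k ∧ InfCluster ω (k • u)}.Infinite ∧
      Tendsto (fun n : ℕ =>
          chemDistR ω 0 ((Nat.nth (fun k => 0 < k ∧ InfCluster ω (k • u)) n) • u) /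
            (Nat.nth (fun k => 0 < k ∧ InfCluster ω (k • u)) n))
        atTop (nhds (μ (toR u))) := by
  have hp0 : 0 ≤ p := by
    refine le_trans ?_ hp
    have : (1 : ℝ) ≤ m := by exact_mod_cast hm
    rw [sub_nonneg, div_le_one (by positivity)]
    linarith
  obtain ⟨P, hP⟩ := exists_isProductBernoulli (EdgeT d) hp0 hp1
  have hprob := hP.1
  have hae := hμ.2 P hP
  have hbad := measure_not_goodAxis_le hd hP i hm hp
  by_contra! hne
  have hle : P Set.univ ≤ P {ω | ¬ GoodAxis ω i m} := by
    refine measure_mono_ae ?_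
    filter_upwards [hae] with ω hω _ hgood
    obtain ⟨u, hu, hfail⟩ := hne ω hgood
    obtain ⟨h1, h2⟩ := hω hgood.infCluster u hu
    exact hfail h1 h2
  rw [measure_univ] at hle
  exact absurd (hle.trans hbad) (by simp)

lemma TimeConstant.axis_le (hd : 2 ≤ d) {p : ℝ} (hμ : TimeConstant d p μ) {m : ℕ} (hm : 0 < m)
    (hp : 1 - 1 / (32 * m) ≤ p) (hp1 : p ≤ 1) (i : Fin d) :
    μ (Pi.single i 1) ≤ 1 + 4 / m := by
  obtain ⟨ω, hgood, hω⟩ := exists_goodAxis hd hμ hm hp hp1 i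
  have hu : (Pi.single i (1 : ℤ) : Vert d) ≠ 0 := by simp
  obtain ⟨hinf, hlim⟩ := hω _ hu
  have htoR : toR (Pi.single i (1 : ℤ)) = (Pi.single i 1 : Fin d → ℝ) := by
    ext m
    simp only [toR, Pi.single_apply]
    split_ifs <;> simp
  rw [← htoR]
  refine le_of_tendsto_of_frequently hlim ?_
  rw [frequently_atTop]
  intro N
  set Q : ℕ → Prop := fun k => 0 < k ∧ InfCluster ω (k • (Pi.single i (1 : ℤ) : Vert d))
  classical
  obtain ⟨k, hk, hconn, hdist⟩ := frequently_atTop.1 hgood (Nat.nth Q N + 1)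
  have hk0 : 0 < k := by omega
  have hQk : Q k := ⟨hk0, hgood.infCluster.of_conn hconn⟩
  refine ⟨Nat.count Q k, ?_, ?_⟩
  · rw [← Nat.count_nth_of_infinite hinf N]
    exact Nat.count_monotone Q (by omega)
  · rw [Nat.nth_count hQk]
    have hk' : (0 : ℝ) < k := by exact_mod_cast hk0
    have hm' : (0 : ℝ) < m := by exact_mod_cast hm
    rw [div_le_iff₀ hk', ← mul_le_mul_iff_right₀ hm']
    refine hdist.trans_eq ?_
    field_simp

lemma TimeConstant.nrm1_le (hd : 2 ≤ d) {p : ℝ} (hμ : TimeConstant d p μ)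
    (hp : 31 / 32 ≤ p) (hp1 : p ≤ 1) (x : Fin d → ℝ) : nrm1 x ≤ μ x := by
  refine hμ.1.nrm1_le (fun u => ?_) x
  by_cases hu : u = 0
  · subst hu
    simpa [nrm1, toR] using hμ.1.nonneg _
  obtain ⟨ω, -, hω⟩ := exists_goodAxis hd hμ one_pos (by norm_num; linarith) hp1 ⟨0, by omega⟩
  obtain ⟨hinf, hlim⟩ := hω u hu
  have hne : toR u ≠ 0 := by
    intro h
    apply hu
    ext i
    simpa [toR] using congrFun h i
  have hpos : 0 < μ (toR u) :=
    lt_of_le_of_ne (hμ.1.nonneg _) fun h => hne ((hμ.1.eq_zero_iff _).1 h.symm)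
  refine ge_of_tendsto hlim ?_
  filter_upwards [hlim.eventually (lt_mem_nhds hpos)] with n hn
  set k := Nat.nth (fun k => 0 < k ∧ InfCluster ω (k • u)) n
  have hk : 0 < k := (Nat.nth_mem_of_infinite hinf n).1
  have hk' : (0 : ℝ) < k := by exact_mod_cast hk
  have hconn : Conn ω 0 (k • u) := by
    intro htop
    rw [chemDistR, htop] at hn
    simp at hn
  rw [le_div_iff₀ hk']
  calc nrm1 (toR u) * k = nrm1 (toR (k • u)) := by
        simp only [nrm1, toR, Finset.sum_mul]
        refine Finset.sum_congr rfl fun i _ => ?_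
        simp [abs_mul, mul_comm]
    _ ≤ _ := nrm1_le_chemDistR hconn

end TimeConstant

/-- **Continuity of `p ↦ μ_p` at `p = 1`:**
`sup_{‖x‖₁ ≤ 1} |μ_p(x) - ‖x‖₁| → 0` as `p → 1` in `(p_c(d), 1]`; in particular, for
every `α > 0` there is `p' ∈ (p_c(d),1)` such that `‖x‖₁ ≤ μ_p(x) ≤ (1+α)‖x‖₁` for every
`p ∈ (p', 1]` and every `x ∈ ℝ^d`. -/
theorem continuity_of_time_constant_at_one (d : ℕ) (hd : 2 ≤ d)
    (μ : ℝ → (Fin d → ℝ) → ℝ)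
    (hμ : ∀ p ∈ Set.Ioc (pc d) (1 : ℝ), TimeConstant d p (μ p)) :
    Tendsto (fun p => sSup {r : ℝ | ∃ x : Fin d → ℝ, nrm1 x ≤ 1 ∧ r = |μ p x - nrm1 x|})
        (nhdsWithin 1 (Set.Ioc (pc d) 1)) (nhds 0) ∧
      ∀ α : ℝ, 0 < α → ∃ p' : ℝ, pc d < p' ∧ p' < 1 ∧
        ∀ p : ℝ, p' < p → p ≤ 1 → ∀ x : Fin d → ℝ,
          nrm1 x ≤ μ p x ∧ μ p x ≤ (1 + α) * nrm1 x := by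
  have hbounds : ∀ α : ℝ, 0 < α → ∃ p' : ℝ, pc d < p' ∧ p' < 1 ∧
      ∀ p : ℝ, p' < p → p ≤ 1 → ∀ x : Fin d → ℝ,
        nrm1 x ≤ μ p x ∧ μ p x ≤ (1 + α) * nrm1 x := by
    intro α hα
    obtain ⟨m, hm⟩ := exists_nat_gt (max 2 (4 / α))
    have hm2 : (2 : ℝ) < m := (le_max_left _ _).trans_lt hm
    have hmα : 4 / α < m := (le_max_right _ _).trans_lt hm
    have hm0 : 0 < m := by exact_mod_cast (by linarith : (0 : ℝ) < m)
    have hfrac : 1 / (32 * (m : ℝ)) < 1 / 32 := by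
      apply one_div_lt_one_div_of_lt <;> linarith
    have hpc := pc_le hd
    refine ⟨1 - 1 / (32 * m), by linarith, by rw [sub_lt_self_iff]; positivity,
      fun p hp hp1 x => ?_⟩
    have hT := hμ p ⟨by linarith, hp1⟩
    refine ⟨hT.nrm1_le hd (by linarith) hp1 x,
      (hT.1.le_mul_nrm1 (hT.axis_le hd hm0 hp.le hp1) x).trans ?_⟩
    refine mul_le_mul_of_nonneg_right ?_ (nrm1_nonneg x)
    have : 4 / (m : ℝ) ≤ α := by
      rw [div_le_iff₀ (by linarith), mul_comm]
      rw [div_lt_iff₀ hα] at hmα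
      exact hmα.le
    linarith
  refine ⟨?_, hbounds⟩
  rw [Metric.tendsto_nhds]
  intro ε hε
  obtain ⟨p', -, hp', h⟩ := hbounds (ε / 2) (half_pos hε)
  filter_upwards [self_mem_nhdsWithin, mem_nhdsWithin_of_mem_nhds (lt_mem_nhds hp')] with p hp hpp
  have h0 : 0 ≤ sSup {r : ℝ | ∃ x : Fin d → ℝ, nrm1 x ≤ 1 ∧ r = |μ p x - nrm1 x|} := by
    refine Real.sSup_nonneg ?_
    rintro r ⟨x, -, rfl⟩
    exact abs_nonneg _
  have h1 : sSup {r : ℝ | ∃ x : Fin d → ℝ, nrm1 x ≤ 1 ∧ r = |μ p x - nrm1 x|} ≤ ε / 2 := by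
    refine Real.sSup_le ?_ (half_pos hε).le
    rintro r ⟨x, hx, rfl⟩
    obtain ⟨hl, hu⟩ := h p hpp hp.2 x
    rw [abs_of_nonneg (sub_nonneg.2 hl)]
    have := mul_le_mul_of_nonneg_left hx (half_pos hε).le
    linarith
  rw [Real.dist_eq, sub_zero, abs_of_nonneg h0]
  linarith

end ChemDist
end

section
/- (Liggett–Schonmann–Stacey domination.) Let d, k be positive integers. There exists a nondecreasing function π : [0,1] → [0,1] with lim_{δ→1} π(δ) = 1 such that: if Y = {Y_x, x∈ℤ^d} is a family of {0,1}-valued random variables which is locally dependent with range k (i.e. for every a ∈ ℤ^d, Y_a is independent of the family {Y_x : ‖x−a‖₂ ≥ k}) and satisfies P(Y_x = 1) ≥ δ for all x ∈ ℤ^d, then the law of Y on {0,1}^{ℤ^d} stochastically dominates the product measure Ber(π(δ))^{⊗ℤ^d}. -/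
open MeasureTheory Filter
open scoped ENNReal

namespace ChemDist

section Thinning

variable {ι : Type*}

/-- The indicator of a Boolean, as a real number. -/
noncomputable def bit (b : Bool) : ℝ := if b then 1 else 0

/-- The conditional probability, given `η`, that the independent `r`-thinning of `η` is `1` on `T`
and `0` on `U`. -/
noncomputable def thinWeight (r : ℝ) (T U : Finset ι) (η : ι → Bool) : ℝ :=
  (∏ i ∈ T, r * bit (η i)) * ∏ i ∈ U, (1 - r * bit (η i))

lemma bit_nonneg (b : Bool) : 0 ≤ bit b := by unfold bit; split <;> norm_num

lemma bit_le_one (b : Bool) : bit b ≤ 1 := by unfold bit; split <;> norm_num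

lemma measurable_bit : Measurable bit := measurable_from_top

lemma mul_bit_nonneg {r : ℝ} (hr0 : 0 ≤ r) (b : Bool) : 0 ≤ r * bit b :=
  mul_nonneg hr0 (bit_nonneg b)

lemma mul_bit_le {r : ℝ} (hr0 : 0 ≤ r) (b : Bool) : r * bit b ≤ r :=
  mul_le_of_le_one_right hr0 (bit_le_one b)

lemma thinWeight_nonneg {r : ℝ} (hr0 : 0 ≤ r) (hr1 : r ≤ 1) (T U : Finset ι) (η : ι → Bool) :
    0 ≤ thinWeight r T U η :=
  mul_nonneg (Finset.prod_nonneg fun i _ => mul_bit_nonneg hr0 _)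
    (Finset.prod_nonneg fun i _ => by linarith [mul_bit_le hr0 (η i)])

lemma prod_zeros_le_one {r : ℝ} (hr0 : 0 ≤ r) (hr1 : r ≤ 1) (U : Finset ι) (η : ι → Bool) :
    ∏ i ∈ U, (1 - r * bit (η i)) ≤ 1 :=
  Finset.prod_le_one (fun i _ => by linarith [mul_bit_le hr0 (η i)])
    fun i _ => by linarith [mul_bit_nonneg hr0 (η i)]

lemma thinWeight_le_pow {r : ℝ} (hr0 : 0 ≤ r) (hr1 : r ≤ 1) (T U : Finset ι) (η : ι → Bool) :
    thinWeight r T U η ≤ r ^ T.card := by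
  have h1 : ∏ i ∈ T, r * bit (η i) ≤ r ^ T.card :=
    (Finset.prod_le_prod (fun i _ => mul_bit_nonneg hr0 _) fun i _ => mul_bit_le hr0 _).trans_eq
      (Finset.prod_const r)
  calc thinWeight r T U η ≤ r ^ T.card * 1 :=
        mul_le_mul h1 (prod_zeros_le_one hr0 hr1 U η)
          (Finset.prod_nonneg fun i _ => by linarith [mul_bit_le hr0 (η i)]) (by positivity)
    _ = _ := mul_one _

lemma measurable_thinWeight {Ω : Type*} {m : MeasurableSpace Ω} (r : ℝ) (T U : Finset ι)
    {Y : ι → Ω → Bool} (hT : ∀ i ∈ T, Measurable (Y i)) (hU : ∀ i ∈ U, Measurable (Y i)) :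
    Measurable fun ω => thinWeight r T U fun i => Y i ω := by
  unfold thinWeight
  refine (Finset.measurable_fun_prod _ fun i hi => ?_).mul
    (Finset.measurable_fun_prod _ fun i hi => ?_)
  · exact (measurable_bit.comp (hT i hi)).const_mul r
  · exact ((measurable_bit.comp (hU i hi)).const_mul r).const_sub 1

variable [DecidableEq ι]

lemma thinWeight_insert_left (r : ℝ) {s : ι} {T : Finset ι} (hs : s ∉ T) (U : Finset ι)
    (η : ι → Bool) :
    thinWeight r (insert s T) U η = r * bit (η s) * thinWeight r T U η := by
  simp only [thinWeight, Finset.prod_insert hs]; ring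

lemma thinWeight_insert_right (r : ℝ) {s : ι} (T : Finset ι) {U : Finset ι} (hs : s ∉ U)
    (η : ι → Bool) :
    thinWeight r T (insert s U) η = (1 - r * bit (η s)) * thinWeight r T U η := by
  simp only [thinWeight, Finset.prod_insert hs]; ring

lemma thinWeight_union (r : ℝ) {T T' U U' : Finset ι} (hT : Disjoint T T') (hU : Disjoint U U')
    (η : ι → Bool) :
    thinWeight r (T ∪ T') (U ∪ U') η = thinWeight r T U η * thinWeight r T' U' η := by
  simp only [thinWeight, Finset.prod_union hT, Finset.prod_union hU]; ring

lemma sum_thinWeight (r : ℝ) (A : Finset ι) (η : ι → Bool) :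
    ∑ T ∈ A.powerset, thinWeight r T (A \ T) η = 1 := by
  unfold thinWeight
  rw [← Finset.prod_add]
  exact Finset.prod_eq_one fun i _ => by ring

/-- A thinning lies below the original configuration. -/
lemma sum_mul_thinWeight_le {r : ℝ} (hr0 : 0 ≤ r) (hr1 : r ≤ 1) (A : Finset ι) (η : ι → Bool)
    {g : Finset ι → ℝ} (hg : Monotone g) :
    ∑ T ∈ A.powerset, thinWeight r T (A \ T) η * g T ≤ g (A.filter fun i => η i = true) := by
  calc ∑ T ∈ A.powerset, thinWeight r T (A \ T) η * g T
      ≤ ∑ T ∈ A.powerset, thinWeight r T (A \ T) η * g (A.filter fun i => η i = true) := by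
        refine Finset.sum_le_sum fun T hT => ?_
        by_cases h : ∀ i ∈ T, η i = true
        · refine mul_le_mul_of_nonneg_left (hg fun i hi => ?_) (thinWeight_nonneg hr0 hr1 _ _ _)
          exact Finset.mem_filter.2 ⟨Finset.mem_powerset.1 hT hi, h i hi⟩
        · push Not at h
          obtain ⟨i, hi, hηi⟩ := h
          have : thinWeight r T (A \ T) η = 0 := by
            unfold thinWeight
            rw [Finset.prod_eq_zero hi (by simp [bit, hηi]), zero_mul]
          simp [this]
    _ = _ := by rw [← Finset.sum_mul, sum_thinWeight, one_mul]

/-- Sequential domination: if each new coordinate is `1` with conditional probability at least `q`,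
then the law dominates the Bernoulli product law. `W T U` is the probability of seeing `1` on `T`
and `0` on `U`. -/
lemma sum_bernoulli_le_sum {q : ℝ} {W : Finset ι → Finset ι → ℝ}
    (h0 : W ∅ ∅ = 1)
    (hadd : ∀ s T U, s ∉ T → s ∉ U → W (insert s T) U + W T (insert s U) = W T U)
    (hq : ∀ s T U, Disjoint T U → s ∉ T → s ∉ U → q * W T U ≤ W (insert s T) U)
    (A : Finset ι) {g : Finset ι → ℝ} (hq0 : 0 ≤ q) (hq1 : q ≤ 1) (hg : Monotone g) :
    ∑ T ∈ A.powerset, q ^ T.card * (1 - q) ^ (A \ T).card * g T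
      ≤ ∑ T ∈ A.powerset, W T (A \ T) * g T := by
  induction A using Finset.induction_on generalizing g with
  | empty => simp [h0]
  | insert s A hs ih =>
    have key := @ih (fun T => (1 - q) * g T + q * g (insert s T)) (by
      intro T T' h
      have h1 := hg h
      have h2 := hg (Finset.insert_subset_insert s h)
      have h3 := mul_le_mul_of_nonneg_left h1 (sub_nonneg.2 hq1)
      have h4 := mul_le_mul_of_nonneg_left h2 hq0
      exact add_le_add h3 h4)
    rw [Finset.sum_powerset_insert hs, Finset.sum_powerset_insert hs, ← Finset.sum_add_distrib,
      ← Finset.sum_add_distrib]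
    refine le_trans (le_of_eq ?_) (key.trans ?_)
    · refine Finset.sum_congr rfl fun T hT => ?_
      have hsT : s ∉ T := fun h => hs (Finset.mem_powerset.1 hT h)
      have hsU : s ∉ A \ T := fun h => hs (Finset.sdiff_subset h)
      rw [Finset.insert_sdiff_of_notMem _ hsT, Finset.insert_sdiff_insert,
        Finset.sdiff_insert_of_notMem hs, Finset.card_insert_of_notMem hsT,
        Finset.card_insert_of_notMem hsU]
      ring
    · refine Finset.sum_le_sum fun T hT => ?_
      have hsT : s ∉ T := fun h => hs (Finset.mem_powerset.1 hT h)
      have hsU : s ∉ A \ T := fun h => hs (Finset.sdiff_subset h)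
      rw [Finset.insert_sdiff_of_notMem _ hsT, Finset.insert_sdiff_insert,
        Finset.sdiff_insert_of_notMem hs]
      have h1 := hadd s T (A \ T) hsT hsU
      have h2 := hq s T (A \ T) Finset.disjoint_sdiff hsT hsU
      have h3 := hg (Finset.subset_insert s T)
      have h4 := mul_le_mul_of_nonneg_right h2 (sub_nonneg.2 h3)
      have h5 : W T (insert s (A \ T)) = W T (A \ T) - W (insert s T) (A \ T) := by linarith
      rw [h5]
      linarith

end Thinning

section LocalDependence

variable {ι Ω : Type*} {mΩ : MeasurableSpace Ω} {P : Measure Ω}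
  [IsProbabilityMeasure P] {Y : ι → Ω → Bool}

lemma integrable_thinWeight {r : ℝ} (hr0 : 0 ≤ r) (hr1 : r ≤ 1) (hY : ∀ i, Measurable (Y i))
    (T U : Finset ι) : Integrable (fun ω => thinWeight r T U fun i => Y i ω) P := by
  refine Integrable.of_bound
    (measurable_thinWeight r T U (fun i _ => hY i) (fun i _ => hY i)).aestronglyMeasurable 1
    (Eventually.of_forall fun ω => ?_)
  rw [Real.norm_of_nonneg (thinWeight_nonneg hr0 hr1 _ _ _)]
  exact (thinWeight_le_pow hr0 hr1 _ _ _).trans (pow_le_one₀ hr0 hr1)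

lemma integrable_bit_mul_thinWeight {r : ℝ} (hr0 : 0 ≤ r) (hr1 : r ≤ 1)
    (hY : ∀ i, Measurable (Y i)) (s : ι) (T U : Finset ι) :
    Integrable (fun ω => bit (Y s ω) * thinWeight r T U fun i => Y i ω) P := by
  refine (integrable_thinWeight hr0 hr1 hY T U).bdd_mul (c := 1)
    (measurable_bit.comp (hY s)).aestronglyMeasurable (Eventually.of_forall fun ω => ?_)
  rw [Real.norm_of_nonneg (bit_nonneg _)]
  exact bit_le_one _

variable [DecidableEq ι]

/-- In a locally dependent field with high density, a site is `1` with conditional probability at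
least `α` given any thinned configuration on finitely many other sites. -/
lemma mul_integral_thinWeight_le {r α δ : ℝ} {n : ℕ} (hr0 : 0 ≤ r) (hr1 : r ≤ 1) (hα0 : 0 ≤ α)
    (hα1 : α ≤ 1) (hY : ∀ i, Measurable (Y i)) (N : ι → Finset ι) (hN : ∀ i, (N i).card ≤ n)
    (hind : ∀ a, ProbabilityTheory.Indep (MeasurableSpace.comap (Y a) inferInstance)
      (⨆ x ∈ {x | x ∉ N a}, MeasurableSpace.comap (Y x) inferInstance) P)
    (hδ : ∀ a, δ ≤ ∫ ω, bit (Y a ω) ∂P)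
    (hcond : ∀ a b : ℕ, a + b ≤ n → 1 - δ ≤ (1 - α) * ((1 - r) ^ a * α ^ b))
    (s : ι) (T U : Finset ι) (hTU : Disjoint T U) (hsT : s ∉ T) (hsU : s ∉ U) :
    α * ∫ ω, thinWeight r T U (fun i => Y i ω) ∂P
      ≤ ∫ ω, bit (Y s ω) * thinWeight r T U (fun i => Y i ω) ∂P := by
  induction hm : T.card + U.card using Nat.strong_induction_on generalizing s T U with
  | _ m ih =>
  set I : Finset ι → Finset ι → ℝ := fun T U => ∫ ω, thinWeight r T U (fun i => Y i ω) ∂P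
  have hIdef : ∀ T U, I T U = ∫ ω, thinWeight r T U (fun i => Y i ω) ∂P := fun _ _ => rfl
  have hI0 : ∀ T U, 0 ≤ I T U := fun T U =>
    integral_nonneg fun ω => thinWeight_nonneg hr0 hr1 _ _ _
  set Tn := T.filter (· ∈ N s) with hTn
  set Tf := T.filter (· ∉ N s) with hTf
  set Un := U.filter (· ∈ N s) with hUn
  set Uf := U.filter (· ∉ N s) with hUf
  have hTe : Tn ∪ Tf = T := Finset.filter_union_filter_not_eq _ _
  have hUe : Un ∪ Uf = U := Finset.filter_union_filter_not_eq _ _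
  have hTd : Disjoint Tn Tf := Finset.disjoint_filter_filter_not _ _ _
  have hUd : Disjoint Un Uf := Finset.disjoint_filter_filter_not _ _ _
  have hcard : Un.card + Tn.card ≤ n := by
    rw [← Finset.card_union_of_disjoint]
    · refine (Finset.card_le_card ?_).trans (hN s)
      intro i hi
      simp only [hTn, hUn, Finset.mem_union, Finset.mem_filter] at hi
      tauto
    · exact (hTU.mono (Finset.filter_subset _ _) (Finset.filter_subset _ _)).symm
  -- the near ones each cost a factor `r * α`
  have hones : ∀ S ⊆ Tn, (r * α) ^ S.card * I Tf Uf ≤ I (S ∪ Tf) Uf := by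
    intro S
    induction S using Finset.induction_on with
    | empty => simp
    | insert t S htS ihS =>
      intro hS
      have htTn : t ∈ Tn := hS (Finset.mem_insert_self _ _)
      have htT : t ∈ T := Finset.filter_subset _ _ htTn
      have hSTn : S ⊆ Tn := (Finset.subset_insert _ _).trans hS
      have ht' : t ∉ S ∪ Tf := by
        rw [Finset.mem_union, not_or]
        exact ⟨htS, Finset.disjoint_left.1 hTd htTn⟩
      have hsub : insert t (S ∪ Tf) ⊆ T := by
        rw [← Finset.insert_union, ← hTe]
        exact Finset.union_subset_union hS subset_rfl
      have htU : t ∉ Uf := fun h => Finset.disjoint_left.1 hTU htT (Finset.filter_subset _ _ h)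
      have hlt : (S ∪ Tf).card + Uf.card < m := by
        have h1 := Finset.card_le_card hsub
        rw [Finset.card_insert_of_notMem ht'] at h1
        have h2 : Uf.card ≤ U.card := Finset.card_filter_le _ _
        omega
      have h := ih _ hlt t (S ∪ Tf) Uf
        (hTU.mono ((Finset.subset_insert _ _).trans hsub) (Finset.filter_subset _ _)) ht' htU rfl
      have h2 : I (insert t S ∪ Tf) Uf
          = r * ∫ ω, bit (Y t ω) * thinWeight r (S ∪ Tf) Uf (fun i => Y i ω) ∂P := by
        rw [hIdef, ← integral_const_mul]
        simp only [Finset.insert_union, thinWeight_insert_left r ht', mul_assoc]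
      rw [h2, Finset.card_insert_of_notMem htS, pow_succ]
      calc (r * α) ^ S.card * (r * α) * I Tf Uf
          = r * (α * ((r * α) ^ S.card * I Tf Uf)) := by ring
        _ ≤ r * (α * I (S ∪ Tf) Uf) := by gcongr; exact ihS hSTn
        _ ≤ _ := by gcongr
  -- the near zeros each cost a factor `1 - r`
  have hzeros : (1 - r) ^ Un.card * I T Uf ≤ I T U := by
    rw [hIdef, hIdef, ← integral_const_mul]
    refine integral_mono ((integrable_thinWeight hr0 hr1 hY _ _).const_mul _)
      (integrable_thinWeight hr0 hr1 hY _ _) fun ω => ?_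
    have h := thinWeight_union r (T := ∅) (T' := T) (Finset.disjoint_empty_left _) hUd
      (fun i => Y i ω)
    rw [Finset.empty_union, hUe] at h
    simp only [h]
    refine mul_le_mul_of_nonneg_right ?_ (thinWeight_nonneg hr0 hr1 _ _ _)
    simp only [thinWeight, Finset.prod_empty, one_mul]
    rw [← Finset.prod_const]
    exact Finset.prod_le_prod (fun i _ => sub_nonneg.2 hr1)
      fun i _ => by linarith [mul_bit_le hr0 (Y i ω)]
  have hT1 := hones Tn subset_rfl
  rw [hTe] at hT1
  -- the far sites are independent of `Y s`
  have hindep : ∫ ω, (1 - bit (Y s ω)) * thinWeight r Tf Uf (fun i => Y i ω) ∂P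
      = (∫ ω, (1 - bit (Y s ω)) ∂P) * I Tf Uf := by
    have hle : ∀ i ∉ N s, Measurable[⨆ x ∈ {x | x ∉ N s},
        MeasurableSpace.comap (Y x) inferInstance] (Y i) := fun i hi =>
      Measurable.mono (comap_measurable (Y i))
        (le_iSup₂_of_le (f := fun x (_ : x ∈ {x | x ∉ N s}) =>
          MeasurableSpace.comap (Y x) inferInstance) i hi le_rfl) le_rfl
    refine ProbabilityTheory.IndepFun.integral_fun_mul_eq_mul_integral ?_
      ((measurable_bit.comp (hY s)).const_sub 1).aestronglyMeasurable
      (measurable_thinWeight r _ _ (fun i _ => hY i) (fun i _ => hY i)).aestronglyMeasurable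
    refine (ProbabilityTheory.IndepFun_iff_Indep _ _ _).2 ?_
    refine ProbabilityTheory.indep_of_indep_of_le_left
      (ProbabilityTheory.indep_of_indep_of_le_right (hind s) ?_) ?_
    · rw [← measurable_iff_comap_le]
      exact measurable_thinWeight r Tf Uf (fun i hi => hle i (Finset.mem_filter.1 hi).2)
        (fun i hi => hle i (Finset.mem_filter.1 hi).2)
    · rw [← measurable_iff_comap_le]
      exact (measurable_bit.comp (comap_measurable (Y s))).const_sub 1
  have hbit : Integrable (fun ω => bit (Y s ω)) P := by
    simpa [thinWeight] using integrable_bit_mul_thinWeight (P := P) hr0 hr1 hY s ∅ ∅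
  have hs1 : ∫ ω, (1 - bit (Y s ω)) ∂P ≤ 1 - δ := by
    rw [integral_sub (integrable_const _) hbit]
    simpa using sub_le_sub_left (hδ s) 1
  have hInt : ∀ T U, Integrable
      (fun ω => (1 - bit (Y s ω)) * thinWeight r T U (fun i => Y i ω)) P := fun T U => by
    simp only [sub_mul, one_mul]
    exact (integrable_thinWeight hr0 hr1 hY _ _).sub
      (integrable_bit_mul_thinWeight hr0 hr1 hY _ _ _)
  have hup : ∫ ω, (1 - bit (Y s ω)) * thinWeight r T U (fun i => Y i ω) ∂P
      ≤ r ^ Tn.card * ((1 - δ) * I Tf Uf) := by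
    calc _ ≤ ∫ ω, r ^ Tn.card * ((1 - bit (Y s ω)) * thinWeight r Tf Uf (fun i => Y i ω)) ∂P := by
          refine integral_mono (hInt _ _) ((hInt _ _).const_mul _) fun ω => ?_
          have h := thinWeight_union r hTd hUd (fun i => Y i ω)
          rw [hTe, hUe] at h
          simp only [h]
          have h1 := mul_le_mul_of_nonneg_right (thinWeight_le_pow hr0 hr1 Tn Un fun i => Y i ω)
            (mul_nonneg (sub_nonneg.2 (bit_le_one (Y s ω)))
              (thinWeight_nonneg hr0 hr1 Tf Uf fun i => Y i ω))
          linarith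
      _ = r ^ Tn.card * ((∫ ω, (1 - bit (Y s ω)) ∂P) * I Tf Uf) := by
          rw [integral_const_mul, hindep]
      _ ≤ _ := by
          gcongr
          exact hI0 _ _
  have hsplit : ∫ ω, (1 - bit (Y s ω)) * thinWeight r T U (fun i => Y i ω) ∂P
      = I T U - ∫ ω, bit (Y s ω) * thinWeight r T U (fun i => Y i ω) ∂P := by
    simp only [sub_mul, one_mul]
    exact integral_sub (integrable_thinWeight hr0 hr1 hY _ _)
      (integrable_bit_mul_thinWeight hr0 hr1 hY _ _ _)
  have hfinal : r ^ Tn.card * ((1 - δ) * I Tf Uf) ≤ (1 - α) * I T U := by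
    calc r ^ Tn.card * ((1 - δ) * I Tf Uf)
        ≤ r ^ Tn.card * ((1 - α) * ((1 - r) ^ Un.card * α ^ Tn.card) * I Tf Uf) := by
          gcongr
          · exact hI0 _ _
          exact hcond _ _ hcard
      _ = (1 - α) * ((1 - r) ^ Un.card * ((r * α) ^ Tn.card * I Tf Uf)) := by
          rw [mul_pow]; ring
      _ ≤ (1 - α) * ((1 - r) ^ Un.card * I T Uf) := by
          have := sub_nonneg.2 hr1
          have := sub_nonneg.2 hα1
          gcongr
      _ ≤ _ := mul_le_mul_of_nonneg_left hzeros (sub_nonneg.2 hα1)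
  change α * I T U ≤ _
  linarith

/-- Domination of a Bernoulli product law on finitely many sites. -/
lemma sum_bernoulli_le_integral {r α : ℝ} (hr0 : 0 ≤ r) (hr1 : r ≤ 1) (hα0 : 0 ≤ α)
    (hα1 : α ≤ 1) (hY : ∀ i, Measurable (Y i))
    (hsite : ∀ (s : ι) (T U : Finset ι), Disjoint T U → s ∉ T → s ∉ U →
      α * ∫ ω, thinWeight r T U (fun i => Y i ω) ∂P
        ≤ ∫ ω, bit (Y s ω) * thinWeight r T U (fun i => Y i ω) ∂P)
    (A : Finset ι) {g : Finset ι → ℝ} (hg : Monotone g)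
    (hInt : Integrable (fun ω => g (A.filter fun i => Y i ω = true)) P) :
    ∑ T ∈ A.powerset, (r * α) ^ T.card * (1 - r * α) ^ (A \ T).card * g T
      ≤ ∫ ω, g (A.filter fun i => Y i ω = true) ∂P := by
  have hq1 : r * α ≤ 1 := mul_le_one₀ hr1 hα0 hα1
  refine (sum_bernoulli_le_sum (W := fun T U => ∫ ω, thinWeight r T U (fun i => Y i ω) ∂P)
    (by simp [thinWeight]) ?_ ?_ A (mul_nonneg hr0 hα0) hq1 hg).trans ?_
  · intro s T U hsT hsU
    rw [← integral_add (integrable_thinWeight hr0 hr1 hY _ _)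
      (integrable_thinWeight hr0 hr1 hY _ _)]
    refine integral_congr_ae (Eventually.of_forall fun ω => ?_)
    simp only [thinWeight_insert_left r hsT, thinWeight_insert_right r T hsU]
    ring
  · intro s T U hTU hsT hsU
    simp only [thinWeight_insert_left r hsT, mul_assoc]
    rw [integral_const_mul]
    exact mul_le_mul_of_nonneg_left (hsite s T U hTU hsT hsU) hr0
  · simp only [← integral_mul_const]
    rw [← integral_finsetSum _ fun T _ => (integrable_thinWeight hr0 hr1 hY _ _).mul_const _]
    exact integral_mono (integrable_finsetSum _ fun T _ =>
      (integrable_thinWeight hr0 hr1 hY _ _).mul_const _) hInt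
      fun ω => sum_mul_thinWeight_le hr0 hr1 A _ hg

end LocalDependence

section Cylinder

variable {ι : Type*} [DecidableEq ι] {A : Finset ι} {S : Set (ι → Bool)}

lemma eq_ones_iff {T : Finset ι} (hT : T ⊆ A) (ω : ι → Bool) :
    A.filter (fun i => ω i = true) = T ↔ ∀ e ∈ A, ω e = decide (e ∈ T) := by
  constructor
  · rintro rfl e he
    by_cases h : ω e = true <;> simp_all
  · intro h
    ext e
    rw [Finset.mem_filter]
    constructor
    · rintro ⟨he, hω⟩
      rw [h e he] at hω
      simpa using hω
    · intro he
      exact ⟨hT he, by rw [h e (hT he)]; simpa using he⟩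

lemma mem_iff_ones_mem (hS : ∀ ω ω' : ι → Bool, (∀ i ∈ A, ω i = ω' i) → ω ∈ S → ω' ∈ S)
    (ω : ι → Bool) :
    ω ∈ S ↔ (fun i => decide (i ∈ A.filter fun i => ω i = true)) ∈ S := by
  have h := (eq_ones_iff (Finset.filter_subset (fun i => ω i = true) A) ω).1 rfl
  exact ⟨hS _ _ h, hS _ _ fun i hi => (h i hi).symm⟩

lemma measurableSet_ones_eq {T : Finset ι} (hT : T ⊆ A) :
    MeasurableSet ((fun ω : ι → Bool => A.filter fun i => ω i = true) ⁻¹' {T}) := by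
  have : (fun ω : ι → Bool => A.filter fun i => ω i = true) ⁻¹' {T}
      = ⋂ e ∈ A, {ω | ω e = decide (e ∈ T)} := by
    ext ω
    simp only [Set.mem_preimage, Set.mem_singleton_iff, eq_ones_iff hT, Set.mem_iInter,
      Set.mem_ofPred_eq]
  rw [this]
  exact A.measurableSet_biInter fun e _ => measurable_pi_apply e (measurableSet_singleton _)

open Classical in
lemma cylinder_eq_preimage
    (hS : ∀ ω ω' : ι → Bool, (∀ i ∈ A, ω i = ω' i) → ω ∈ S → ω' ∈ S) :
    S = (fun ω : ι → Bool => A.filter fun i => ω i = true) ⁻¹'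
      ↑(A.powerset.filter fun T => (fun i => decide (i ∈ T)) ∈ S) := by
  ext ω
  rw [mem_iff_ones_mem hS ω]
  simp

lemma measurableSet_cylinder
    (hS : ∀ ω ω' : ι → Bool, (∀ i ∈ A, ω i = ω' i) → ω ∈ S → ω' ∈ S) : MeasurableSet S := by
  classical
  rw [cylinder_eq_preimage hS, ← Set.biUnion_preimage_singleton]
  refine Finset.measurableSet_biUnion _ fun T hT => measurableSet_ones_eq ?_
  exact Finset.mem_powerset.1 (Finset.mem_filter.1 hT).1

open Classical in
lemma IsProductBernoulli.real_cylinder {q : ℝ} (hq0 : 0 ≤ q) (hq1 : q ≤ 1)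
    {Q : Measure (ι → Bool)} (hQ : IsProductBernoulli q Q)
    (hS : ∀ ω ω' : ι → Bool, (∀ i ∈ A, ω i = ω' i) → ω ∈ S → ω' ∈ S) :
    Q.real S = ∑ T ∈ A.powerset, q ^ T.card * (1 - q) ^ (A \ T).card *
      (if (fun i => decide (i ∈ T)) ∈ S then 1 else 0) := by
  have := hQ.1
  have hsub : ∀ T ∈ A.powerset.filter (fun T => (fun i => decide (i ∈ T)) ∈ S), T ⊆ A :=
    fun T hT => Finset.mem_powerset.1 (Finset.mem_filter.1 hT).1
  conv_lhs => rw [cylinder_eq_preimage hS]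
  rw [← sum_measureReal_preimage_singleton _ fun T hT => measurableSet_ones_eq (hsub T hT)]
  simp only [mul_ite, mul_one, mul_zero]
  rw [← Finset.sum_filter]
  refine Finset.sum_congr rfl fun T hT => ?_
  have hset : (fun ω : ι → Bool => A.filter fun i => ω i = true) ⁻¹' {T}
      = {ω | ∀ e ∈ A, ω e = (fun i => decide (i ∈ T)) e} := by
    ext ω
    exact eq_ones_iff (hsub T hT) ω
  rw [measureReal_def, hset, hQ.2, ENNReal.toReal_prod]
  simp only [decide_eq_true_eq, apply_ite ENNReal.toReal, ENNReal.toReal_ofReal hq0,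
    ENNReal.toReal_ofReal (sub_nonneg.2 hq1)]
  rw [Finset.prod_ite, Finset.prod_const, Finset.prod_const, Finset.filter_mem_eq_inter,
    Finset.inter_eq_right.2 (hsub T hT), Finset.filter_notMem_eq_sdiff]

/-- Cylinder upper sets: the finite-volume comparison in terms of probabilities. -/
lemma IsProductBernoulli.real_cylinder_le {Ω : Type*} {mΩ : MeasurableSpace Ω} {P : Measure Ω}
    [IsProbabilityMeasure P] {Y : ι → Ω → Bool} {r α : ℝ} (hr0 : 0 ≤ r) (hr1 : r ≤ 1)
    (hα0 : 0 ≤ α) (hα1 : α ≤ 1) (hY : ∀ i, Measurable (Y i))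
    (hsite : ∀ (s : ι) (T U : Finset ι), Disjoint T U → s ∉ T → s ∉ U →
      α * ∫ ω, thinWeight r T U (fun i => Y i ω) ∂P
        ≤ ∫ ω, bit (Y s ω) * thinWeight r T U (fun i => Y i ω) ∂P)
    {Q : Measure (ι → Bool)} (hQ : IsProductBernoulli (r * α) Q)
    (hS : ∀ ω ω' : ι → Bool, (∀ i ∈ A, ω i = ω' i) → ω ∈ S → ω' ∈ S) (hup : IsUpperSet S) :
    Q.real S ≤ (P.map fun ω i => Y i ω).real S := by
  classical
  have hmeas : Measurable fun ω i => Y i ω := measurable_pi_lambda _ hY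
  have hSm := measurableSet_cylinder hS
  set g : Finset ι → ℝ := fun T => if (fun i => decide (i ∈ T)) ∈ S then 1 else 0 with hg
  have hgmono : Monotone g := by
    intro T T' h
    have hle : (fun i => decide (i ∈ T)) ≤ fun i => decide (i ∈ T') := fun i => by
      by_cases hi : i ∈ T
      · simp [hi, h hi]
      · simp [hi]
    by_cases h1 : (fun i => decide (i ∈ T)) ∈ S
    · simp [hg, h1, hup hle h1]
    · simp only [hg, h1, if_false]
      split <;> norm_num
  have hgeq : (fun ω => g (A.filter fun i => Y i ω = true))
      = ((fun ω i => Y i ω) ⁻¹' S).indicator fun _ => (1 : ℝ) := by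
    ext ω
    by_cases h : (fun i => Y i ω) ∈ S
    · rw [Set.indicator_of_mem (s := (fun ω i => Y i ω) ⁻¹' S) h]
      exact if_pos ((mem_iff_ones_mem hS _).1 h)
    · rw [Set.indicator_of_notMem (s := (fun ω i => Y i ω) ⁻¹' S) h]
      exact if_neg (mt (mem_iff_ones_mem hS _).2 h)
  rw [hQ.real_cylinder (mul_nonneg hr0 hα0) (mul_le_one₀ hr1 hα0 hα1) hS,
    map_measureReal_apply hmeas hSm]
  refine (sum_bernoulli_le_integral hr0 hr1 hα0 hα1 hY hsite A hgmono ?_).trans_eq ?_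
  · rw [hgeq]
    exact (integrable_const _).indicator (hmeas hSm)
  · rw [hgeq, integral_indicator_const _ (hmeas hSm), smul_eq_mul, mul_one]

end Cylinder

section Extension

variable {ι : Type*} {Q ν : Measure (ι → Bool)}

lemma isClosed_upperClosure_of_isCompact {K : Set (ι → Bool)} (hK : IsCompact K) :
    IsClosed (upperClosure K : Set (ι → Bool)) := by
  have : (upperClosure K : Set (ι → Bool))
      = Prod.snd '' ((K ×ˢ Set.univ) ∩ {p : (ι → Bool) × (ι → Bool) | p.1 ≤ p.2}) := by
    ext ω
    simp only [SetLike.mem_coe, mem_upperClosure, Set.mem_image, Set.mem_inter_iff, Set.mem_prod,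
      Set.mem_univ, and_true, Set.mem_ofPred_eq, Prod.exists, exists_eq_right]
  rw [this]
  have hcl : IsClosed {p : (ι → Bool) × (ι → Bool) | p.1 ≤ p.2} := by
    have heq : {p : (ι → Bool) × (ι → Bool) | p.1 ≤ p.2}
        = ⋂ i, (fun p => (p.1 i, p.2 i)) ⁻¹' {b : Bool × Bool | b.1 ≤ b.2} := by
      ext p
      simp [Pi.le_def]
    rw [heq]
    exact isClosed_iInter fun i => (isClosed_discrete _).preimage (by fun_prop)
  exact (((hK.prod isCompact_univ).inter_right hcl).image continuous_snd).isClosed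

lemma mem_of_forall_finset_agree {K : Set (ι → Bool)} (hK : IsClosed K) {ω : ι → Bool}
    (h : ∀ A : Finset ι, ∃ κ ∈ K, ∀ i ∈ A, κ i = ω i) : ω ∈ K := by
  rw [← hK.closure_eq, mem_closure_iff]
  intro o ho hωo
  obtain ⟨A, u, hu, hsub⟩ := isOpen_pi_iff.1 ho ω hωo
  obtain ⟨κ, hκ, hA⟩ := h A
  refine ⟨κ, hsub fun i hi => ?_, hκ⟩
  rw [hA i hi]
  exact (hu i hi).2

/-- Comparison of cylinder upper sets extends to all measurable upper sets. -/
lemma measure_le_of_cylinder_le [Countable ι] [IsFiniteMeasure Q] [IsFiniteMeasure ν]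
    (h : ∀ (A : Finset ι) (S : Set (ι → Bool)),
      (∀ ω ω' : ι → Bool, (∀ i ∈ A, ω i = ω' i) → ω ∈ S → ω' ∈ S) → IsUpperSet S →
        Q S ≤ ν S)
    {S : Set (ι → Bool)} (hSm : MeasurableSet S) (hup : IsUpperSet S) : Q S ≤ ν S := by
  classical
  refine le_of_forall_lt fun c hc => ?_
  obtain ⟨K, hKS, hK, hcK⟩ := hSm.exists_lt_isCompact hc
  refine hcK.trans_le ?_
  set L : Set (ι → Bool) := ↑(upperClosure K)
  have hLcl : IsClosed L := isClosed_upperClosure_of_isCompact hK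
  have hLup : IsUpperSet L := (upperClosure K).upper
  have hLS : L ⊆ S := upperClosure_min hKS hup
  set C : Finset ι → Set (ι → Bool) := fun A => {ω | ∃ κ ∈ L, ∀ i ∈ A, κ i = ω i}
  have hCdep : ∀ A, ∀ ω ω' : ι → Bool, (∀ i ∈ A, ω i = ω' i) → ω ∈ C A → ω' ∈ C A := by
    rintro A ω ω' hωω' ⟨κ, hκ, hA⟩
    exact ⟨κ, hκ, fun i hi => (hA i hi).trans (hωω' i hi)⟩
  have hCup : ∀ A, IsUpperSet (C A) := by
    rintro A ω ω' hle ⟨κ, hκ, hA⟩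
    refine ⟨κ ⊔ ω', hLup le_sup_left hκ, fun i hi => ?_⟩
    rw [Pi.sup_apply, hA i hi]
    exact sup_eq_right.2 (hle i)
  have hCanti : Antitone C := fun A B hAB ω ⟨κ, hκ, hB⟩ => ⟨κ, hκ, fun i hi => hB i (hAB hi)⟩
  have hCinter : ⋂ A, C A = L := by
    refine Set.Subset.antisymm (fun ω hω => mem_of_forall_finset_agree hLcl
      fun A => Set.mem_iInter.1 hω A) ?_
    exact Set.subset_iInter fun A ω hω => ⟨ω, hω, fun _ _ => rfl⟩
  have hνL : ν L = ⨅ A, ν (C A) := by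
    rw [← hCinter]
    exact hCanti.measure_iInter
      (fun A => (measurableSet_cylinder (hCdep A)).nullMeasurableSet) ⟨∅, measure_ne_top _ _⟩
  calc Q K ≤ Q L := measure_mono subset_upperClosure
    _ ≤ ⨅ A, ν (C A) := le_iInf fun A =>
        (measure_mono (hCinter ▸ Set.iInter_subset C A)).trans (h A _ (hCdep A) (hCup A))
    _ = ν L := hνL.symm
    _ ≤ ν S := measure_mono hLS

lemma integral_le_of_upperSet_le [IsProbabilityMeasure Q] [IsProbabilityMeasure ν]
    (h : ∀ S : Set (ι → Bool), MeasurableSet S → IsUpperSet S → Q S ≤ ν S)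
    {f : (ι → Bool) → ℝ} (hfm : Measurable f) (hf : Monotone f) {C : ℝ}
    (hC : ∀ η, |f η| ≤ C) : ∫ η, f η ∂Q ≤ ∫ η, f η ∂ν := by
  have hInt : ∀ μ : Measure (ι → Bool), IsProbabilityMeasure μ → Integrable f μ := fun μ _ =>
    Integrable.of_bound hfm.aestronglyMeasurable C (Eventually.of_forall hC)
  have hnn : ∀ η, 0 ≤ f η + C := fun η => by linarith [neg_le_of_abs_le (hC η)]
  have hcake : ∀ μ : Measure (ι → Bool), IsProbabilityMeasure μ →
      ∫⁻ η, ENNReal.ofReal (f η + C) ∂μ = ∫⁻ t in Set.Ioi 0, μ {η | t < f η + C} := fun μ _ =>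
    lintegral_eq_lintegral_meas_lt μ (Eventually.of_forall hnn) (hfm.add_const C).aemeasurable
  have hshift : ∀ μ : Measure (ι → Bool), IsProbabilityMeasure μ →
      ∫ η, f η ∂μ = (∫⁻ η, ENNReal.ofReal (f η + C) ∂μ).toReal - C := fun μ hμ => by
    rw [← integral_eq_lintegral_of_nonneg_ae (Eventually.of_forall hnn)
      (hfm.add_const C).aestronglyMeasurable, integral_add (hInt μ hμ) (integrable_const C)]
    simp
  have hle : ∫⁻ η, ENNReal.ofReal (f η + C) ∂Q ≤ ∫⁻ η, ENNReal.ofReal (f η + C) ∂ν := by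
    rw [hcake Q inferInstance, hcake ν inferInstance]
    refine lintegral_mono fun t => h _ (measurableSet_lt measurable_const (hfm.add_const C)) ?_
    intro η η' hle (hη : t < f η + C)
    exact hη.trans_le (by linarith [hf hle] : f η + C ≤ f η' + C)
  rw [hshift Q inferInstance, hshift ν inferInstance]
  have hfin : ∫⁻ η, ENNReal.ofReal (f η + C) ∂ν ≠ ⊤ :=
    (((hInt ν inferInstance).add (integrable_const C)).lintegral_lt_top).ne
  exact sub_le_sub_right (ENNReal.toReal_mono hfin hle) C

end Extension

section Parameter

/-- The density `r` solving `(1 - r) ^ (n + 1) = 1 - δ`. -/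
noncomputable def thinDensity (n : ℕ) (δ : ℝ) : ℝ := 1 - (1 - δ) ^ ((n + 1 : ℝ)⁻¹)

variable {n : ℕ} {δ : ℝ}

lemma thinDensity_mem (hδ : δ ∈ Set.Icc (0 : ℝ) 1) : thinDensity n δ ∈ Set.Icc (0 : ℝ) 1 := by
  have h0 : 0 ≤ 1 - δ := sub_nonneg.2 hδ.2
  have h1 : (1 - δ) ^ ((n + 1 : ℝ)⁻¹) ≤ 1 :=
    Real.rpow_le_one h0 (by linarith [hδ.1]) (by positivity)
  have h2 := Real.rpow_nonneg h0 ((n + 1 : ℝ)⁻¹)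
  unfold thinDensity
  constructor <;> linarith

lemma one_sub_thinDensity_pow (hδ : δ ≤ 1) : (1 - thinDensity n δ) ^ (n + 1) = 1 - δ := by
  rw [thinDensity, sub_sub_cancel]
  exact_mod_cast Real.rpow_inv_natCast_pow (sub_nonneg.2 hδ) (Nat.succ_ne_zero n)

lemma thinDensity_monotoneOn : MonotoneOn (thinDensity n) (Set.Iic 1) := by
  intro x _ y hy hxy
  have := Real.rpow_le_rpow (sub_nonneg.2 hy) (by linarith : 1 - y ≤ 1 - x)
    (by positivity : (0 : ℝ) ≤ (n + 1 : ℝ)⁻¹)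
  unfold thinDensity
  linarith

lemma tendsto_thinDensity : Tendsto (thinDensity n) (nhds 1) (nhds 1) := by
  have hc : Continuous (thinDensity n) := by
    unfold thinDensity
    exact continuous_const.sub
      ((continuous_const.sub continuous_id).rpow_const fun _ => Or.inr (by positivity))
  have h := hc.tendsto 1
  have h1 : thinDensity n 1 = 1 := by
    rw [thinDensity, sub_self, Real.zero_rpow (by positivity), sub_zero]
  rwa [h1] at h

lemma one_sub_le_of_half_le (hδ : δ ∈ Set.Icc (0 : ℝ) 1) (hr : 1 / 2 ≤ thinDensity n δ)
    (a b : ℕ) (hab : a + b ≤ n) :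
    1 - δ ≤ (1 - thinDensity n δ) * ((1 - thinDensity n δ) ^ a * thinDensity n δ ^ b) := by
  have hmem := thinDensity_mem (n := n) hδ
  rw [← one_sub_thinDensity_pow (n := n) hδ.2]
  set r := thinDensity n δ
  have h0 : 0 ≤ 1 - r := sub_nonneg.2 hmem.2
  calc (1 - r) ^ (n + 1) ≤ (1 - r) ^ (a + b + 1) :=
        pow_le_pow_of_le_one h0 (by linarith [hmem.1]) (by omega)
    _ = (1 - r) * ((1 - r) ^ a * (1 - r) ^ b) := by ring
    _ ≤ _ := by
        gcongr
        linarith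

end Parameter

/-- **Liggett–Schonmann–Stacey domination** for a field indexed by a countable set in which each
site is independent of all but at most `n` others. -/
theorem integral_le_of_locallyDependent {ι Ω : Type*} [Countable ι] {mΩ : MeasurableSpace Ω}
    {P : Measure Ω} [IsProbabilityMeasure P] {Y : ι → Ω → Bool} {r : ℝ} {n : ℕ} {δ : ℝ}
    (hδ : δ ∈ Set.Icc (0 : ℝ) 1) (hr : r = if thinDensity n δ < 1 / 2 then 0 else thinDensity n δ)
    (hY : ∀ i, Measurable (Y i)) (N : ι → Finset ι) (hN : ∀ i, (N i).card ≤ n)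
    (hind : ∀ a, ProbabilityTheory.Indep (MeasurableSpace.comap (Y a) inferInstance)
      (⨆ x ∈ {x | x ∉ N a}, MeasurableSpace.comap (Y x) inferInstance) P)
    (hdens : ∀ a, ENNReal.ofReal δ ≤ P {ω | Y a ω = true})
    {Q : Measure (ι → Bool)} (hQ : IsProductBernoulli (r * r) Q)
    {f : (ι → Bool) → ℝ} (hfm : Measurable f) (hf : Monotone f) {C : ℝ} (hC : ∀ η, |f η| ≤ C) :
    ∫ η, f η ∂Q ≤ ∫ ω, f (fun i => Y i ω) ∂P := by
  classical
  have hmeas : Measurable fun ω i => Y i ω := measurable_pi_lambda _ hY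
  have := hQ.1
  have : IsProbabilityMeasure (P.map fun ω i => Y i ω) :=
    Measure.isProbabilityMeasure_map hmeas.aemeasurable
  have hmem := thinDensity_mem (n := n) hδ
  have hr01 : r ∈ Set.Icc (0 : ℝ) 1 := by
    rw [hr]
    split
    · simp
    · exact hmem
  have hbit : ∀ a, δ ≤ ∫ ω, bit (Y a ω) ∂P := fun a => by
    have hset : MeasurableSet {ω | Y a ω = true} := hY a (measurableSet_singleton true)
    have heq : (fun ω => bit (Y a ω)) = {ω | Y a ω = true}.indicator fun _ => (1 : ℝ) := by
      ext ω
      simp [bit, Set.indicator_apply]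
    rw [heq, integral_indicator_const _ hset, smul_eq_mul, mul_one, measureReal_def]
    exact (ENNReal.ofReal_le_iff_le_toReal (measure_ne_top _ _)).1 (hdens a)
  have hsite : ∀ (s : ι) (T U : Finset ι), Disjoint T U → s ∉ T → s ∉ U →
      r * ∫ ω, thinWeight r T U (fun i => Y i ω) ∂P
        ≤ ∫ ω, bit (Y s ω) * thinWeight r T U (fun i => Y i ω) ∂P := by
    by_cases h : thinDensity n δ < 1 / 2
    · intro s T U _ _ _
      rw [if_pos h] at hr
      rw [hr, zero_mul]
      exact integral_nonneg fun ω =>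
        mul_nonneg (bit_nonneg _) (thinWeight_nonneg le_rfl zero_le_one _ _ _)
    · rw [if_neg h] at hr
      refine mul_integral_thinWeight_le hr01.1 hr01.2 hr01.1 hr01.2 hY N hN hind hbit ?_
      rw [hr]
      exact one_sub_le_of_half_le hδ (not_lt.1 h)
  rw [← integral_map hmeas.aemeasurable hfm.aestronglyMeasurable]
  refine integral_le_of_upperSet_le (fun S hSm hup => measure_le_of_cylinder_le ?_ hSm hup)
    hfm hf hC
  intro A S hS hup
  exact (ENNReal.toReal_le_toReal (measure_ne_top _ _) (measure_ne_top _ _)).1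
    (hQ.real_cylinder_le hr01.1 hr01.2 hr01.1 hr01.2 hY hsite hS hup)

/-- **Liggett–Schonmann–Stacey domination.**  For positive integers `d, k` there is a
nondecreasing `π : [0,1] → [0,1]` with `π(δ) → 1` as `δ → 1`, such that any locally
dependent field `Y = (Y_x)_{x ∈ ℤ^d}` of `{0,1}`-valued random variables with dependence
range `k` and `P(Y_x = 1) ≥ δ` for all `x`, has a law on `{0,1}^{ℤ^d}` stochastically
dominating the product measure `Ber(π(δ))^{⊗ℤ^d}`. -/
theorem lss_domination (d k : ℕ) (hd : 0 < d) (hk : 0 < k) :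
    ∃ π : ℝ → ℝ,
      MonotoneOn π (Set.Icc 0 1) ∧
      (∀ δ ∈ Set.Icc (0 : ℝ) 1, π δ ∈ Set.Icc (0 : ℝ) 1) ∧
      Tendsto π (nhdsWithin 1 (Set.Ico 0 1)) (nhds 1) ∧
      ∀ (Ω' : Type) (mΩ : MeasurableSpace Ω') (P' : Measure Ω'),
        IsProbabilityMeasure P' →
        ∀ Y : (Fin d → ℤ) → Ω' → Bool, (∀ x, Measurable (Y x)) →
          -- local dependence with range `k`: `Y_a` is independent of
          -- `{Y_x : ‖x - a‖₂ ≥ k}`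
          (∀ a : Fin d → ℤ,
            ProbabilityTheory.Indep
              (MeasurableSpace.comap (Y a) (inferInstance : MeasurableSpace Bool))
              (⨆ x ∈ {x : Fin d → ℤ | (k : ℝ) ≤ Real.sqrt (∑ i, ((x i - a i : ℤ) : ℝ) ^ 2)},
                MeasurableSpace.comap (Y x) (inferInstance : MeasurableSpace Bool)) P') →
          ∀ δ : ℝ, δ ∈ Set.Icc (0 : ℝ) 1 →
            (∀ x : Fin d → ℤ, ENNReal.ofReal δ ≤ P' {ωp | Y x ωp = true}) →
            -- the law of `Y` stochastically dominates `Ber(π(δ))^{⊗ℤ^d}`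
            ∀ Q : Measure ((Fin d → ℤ) → Bool), IsProductBernoulli (π δ) Q →
              ∀ f : ((Fin d → ℤ) → Bool) → ℝ, Measurable f → Monotone f →
                (∃ C : ℝ, ∀ η, |f η| ≤ C) →
                ∫ η, f η ∂Q ≤ ∫ ωp, f (fun x => Y x ωp) ∂P' := by
  set n : ℕ := (2 * k + 1) ^ d
  set ρ : ℝ → ℝ := fun δ => if thinDensity n δ < 1 / 2 then 0 else thinDensity n δ with hρ
  have hρmem : ∀ δ ∈ Set.Icc (0 : ℝ) 1, ρ δ ∈ Set.Icc (0 : ℝ) 1 := fun δ hδ => by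
    simp only [hρ]
    split
    · simp
    · exact thinDensity_mem hδ
  have hρmono : MonotoneOn ρ (Set.Icc 0 1) := fun x hx y hy hxy => by
    have h := thinDensity_monotoneOn (n := n) hx.2 hy.2 hxy
    simp only [hρ]
    split_ifs <;> linarith
  have hρlim : Tendsto ρ (nhds 1) (nhds 1) := by
    refine (tendsto_thinDensity (n := n)).congr' ?_
    filter_upwards [(tendsto_thinDensity (n := n)).eventually_const_lt
      (by norm_num : (1 / 2 : ℝ) < 1)] with δ hδ
    exact (if_neg hδ.not_gt).symm
  refine ⟨fun δ => ρ δ * ρ δ, ?_, ?_, ?_, ?_⟩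
  · intro x hx y hy hxy
    exact mul_le_mul (hρmono hx hy hxy) (hρmono hx hy hxy) (hρmem x hx).1 (hρmem y hy).1
  · intro δ hδ
    have h := hρmem δ hδ
    exact ⟨mul_nonneg h.1 h.1, mul_le_one₀ h.2 h.1 h.2⟩
  · simpa using (hρlim.mul hρlim).mono_left nhdsWithin_le_nhds
  · rintro Ω' mΩ P' hP' Y hY hind δ hδ hdens Q hQ f hfm hf ⟨C, hC⟩
    refine integral_le_of_locallyDependent hδ rfl hY
      (fun a => Fintype.piFinset fun i => Finset.Icc (a i - k) (a i + k)) (fun a => ?_)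
      (fun a => ?_) hdens hQ hfm hf hC
    · rw [Fintype.card_piFinset]
      have h : ∀ i, (Finset.Icc (a i - k) (a i + k)).card = 2 * k + 1 := fun i => by
        rw [Int.card_Icc]
        omega
      simp [h, n]
    · refine ProbabilityTheory.indep_of_indep_of_le_right (hind a) ?_
      refine biSup_mono fun x hx => ?_
      simp only [Set.mem_ofPred_eq, Fintype.mem_piFinset, Finset.mem_Icc, not_forall] at hx ⊢
      obtain ⟨i, hi⟩ := hx
      have habs : (k : ℤ) ≤ |x i - a i| := by
        rw [le_abs]
        omega
      have habs' : (k : ℝ) ≤ |((x i - a i : ℤ) : ℝ)| := by exact_mod_cast habs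
      refine habs'.trans (Real.abs_le_sqrt ?_)
      exact Finset.single_le_sum (f := fun i => ((x i - a i : ℤ) : ℝ) ^ 2)
        (fun i _ => sq_nonneg _) (Finset.mem_univ i)

end ChemDist
end
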